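/- arXiv:2210.09410 — 2 statements merged into one kernel-verified Lean document; each statement's English description precedes it below -/
import Mathlib

section
/- For every n ≥ 2 and every function k : ℕ → ℕ satisfying k_c(n) < k(n) ≤ n for all sufficiently large n, the probability that a uniformly random picture of size n is reconstructible from its k(n)-deck tends to 1 as n → ∞. -/
open Filter

/-- The `k × k` subgrid of a picture `P` of size `n` with top-left offset `(i, j)`.
When `k ≤ n` and `i, j ≤ n - k`, the guard condition always holds and this is the
genuine subgrid `(a, b) ↦ P (i + a, j + b)`. -/
def subgrid (n k : ℕ) (P : Fin n × Fin n → Bool) (i j : ℕ) : Fin k × Fin k → Bool :=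
  fun p =>
    if h : i + (p.1 : ℕ) < n ∧ j + (p.2 : ℕ) < n then
      P (⟨i + (p.1 : ℕ), h.1⟩, ⟨j + (p.2 : ℕ), h.2⟩)
    else false

/-- The `k`-deck of a picture `P` of size `n`: the multiset, indexed over the
`(n - k + 1)²` pairs `(i, j)` with `0 ≤ i, j ≤ n - k`, of its `k × k` subgrids. -/
def deck (n k : ℕ) (P : Fin n × Fin n → Bool) : Multiset (Fin k × Fin k → Bool) :=
  (Finset.univ : Finset (Fin (n - k + 1) × Fin (n - k + 1))).val.map
    (fun q => subgrid n k P (q.1 : ℕ) (q.2 : ℕ))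

/-- A picture `P` of size `n` is reconstructible from its `k`-deck if every picture
of size `n` with the same `k`-deck equals `P`. -/
def Reconstructible (n k : ℕ) (P : Fin n × Fin n → Bool) : Prop :=
  ∀ P' : Fin n × Fin n → Bool, deck n k P' = deck n k P → P' = P

open scoped Classical in
/-- The probability, under the uniform distribution on the `2 ^ (n²)` pictures of
size `n`, that a random picture is reconstructible from its `k`-deck. -/
noncomputable def reconProb (n k : ℕ) : ℝ :=
  (Finset.univ.filter fun P : Fin n × Fin n → Bool =>
      Reconstructible n k P).card / 2 ^ (n ^ 2)

namespace RP

abbrev Pic := ℤ → ℤ → Bool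

/-- transpose -/
def tr (p : Pic) : Pic := fun i j => p j i

/-- horizontal mirror image -/
def flp (n : ℤ) (p : Pic) : Pic := fun i j => p (n - 1 - i) j

/-- the `w × h` boxes of `p` at `x` and of `q` at `y` are equal -/
def Beq (w h : ℤ) (p q : Pic) (x1 x2 y1 y2 : ℤ) : Prop :=
  ∀ i j, 0 ≤ i → i < w → 0 ≤ j → j < h → p (x1 + i) (x2 + j) = q (y1 + i) (y2 + j)

/-- the `w × h` box at `x` lies in the `n × n` square -/
def Val (n w h x1 x2 : ℤ) : Prop := 0 ≤ x1 ∧ x1 + w ≤ n ∧ 0 ≤ x2 ∧ x2 + h ≤ n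

/-- the box at `z` is repeated elsewhere -/
def Rep (n w h : ℤ) (p : Pic) (z1 z2 : ℤ) : Prop :=
  ∃ w1 w2, Val n w h w1 w2 ∧ Beq w h p p z1 z2 w1 w2 ∧ (w1 ≠ z1 ∨ w2 ≠ z2)

def Legal (n k : ℤ) (p p' : Pic) : Prop :=
  ∀ x1 x2, Val n k k x1 x2 → ∃ y1 y2, Val n k k y1 y2 ∧ Beq k k p' p x1 x2 y1 y2

def Far (D x1 x2 y1 y2 : ℤ) : Prop :=
  x1 + D < y1 ∨ y1 + D < x1 ∨ x2 + D < y2 ∨ y2 + D < x2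

/-- agreement of `p'` with `p` shifted by `t`, at position `y` of `p` -/
def Ag (n k : ℤ) (p p' : Pic) (t1 t2 y1 y2 : ℤ) : Prop :=
  Val n k k y1 y2 ∧ Val n k k (y1 - t1) (y2 - t2) ∧ Beq k k p' p (y1 - t1) (y2 - t2) y1 y2

def RowFree (n k K : ℤ) (p : Pic) (u1 b : ℤ) : Prop :=
  ∀ z1, u1 ≤ z1 → z1 ≤ u1 + K + 1 → Val n (k-1) k z1 b → ¬ Rep n (k-1) k p z1 b

def E1 (n k K L : ℤ) (p : Pic) : Prop :=
  ∀ u1 u2, 0 ≤ u1 → u1 ≤ n → 0 ≤ u2 → u2 + L + k ≤ n + 1 →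
    ∃ b, u2 ≤ b ∧ b < u2 + L ∧ RowFree n k (K+1) p u1 b

def Gd (n k K : ℤ) (p p' : Pic) (t1 t2 u1 u2 : ℤ) : Prop :=
  (∀ b, u2 ≤ b → b ≤ u2 + K → RowFree n k K p u1 b →
    ∀ y, u1 ≤ y → y ≤ u1 + K → Ag n k p p' t1 t2 y b) ∧
  (∀ a, u1 ≤ a → a ≤ u1 + K → RowFree n k K (tr p) u2 a →
    ∀ y, u2 ≤ y → y ≤ u2 + K → Ag n k p p' t1 t2 a y)

def Ut (n k K t1 t2 u1 u2 : ℤ) : Prop :=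
  0 ≤ u1 ∧ u1 + K + k ≤ n ∧ 0 ≤ u1 - t1 ∧ u1 - t1 + K + k ≤ n ∧
  0 ≤ u2 ∧ u2 + K + k ≤ n ∧ 0 ≤ u2 - t2 ∧ u2 - t2 + K + k ≤ n

lemma Beq_tr {w h : ℤ} {p q : Pic} {x1 x2 y1 y2 : ℤ} (H : Beq w h p q x1 x2 y1 y2) :
    Beq h w (tr p) (tr q) x2 x1 y2 y1 := fun i j a b c d => H j i c d a b

lemma Val_tr {n w h x1 x2 : ℤ} (H : Val n w h x1 x2) : Val n h w x2 x1 :=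
  ⟨H.2.2.1, H.2.2.2, H.1, H.2.1⟩

lemma Legal_tr {n k : ℤ} {p p' : Pic} (H : Legal n k p p') : Legal n k (tr p) (tr p') := by
  intro x1 x2 hx
  obtain ⟨y1, y2, hy, hb⟩ := H x2 x1 (Val_tr hx)
  exact ⟨y2, y1, Val_tr hy, Beq_tr hb⟩

lemma Ag_tr {n k : ℤ} {p p' : Pic} {t1 t2 y1 y2 : ℤ} (H : Ag n k p p' t1 t2 y1 y2) :
    Ag n k (tr p) (tr p') t2 t1 y2 y1 := ⟨Val_tr H.1, Val_tr H.2.1, Beq_tr H.2.2⟩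

lemma Gd_tr {n k K : ℤ} {p p' : Pic} {t1 t2 u1 u2 : ℤ} (H : Gd n k K p p' t1 t2 u1 u2) :
    Gd n k K (tr p) (tr p') t2 t1 u2 u1 :=
  ⟨fun b h1 h2 h3 y h4 h5 => Ag_tr (H.2 b h1 h2 h3 y h4 h5),
   fun b h1 h2 h3 y h4 h5 => Ag_tr (H.1 b h1 h2 h3 y h4 h5)⟩

lemma Ut_tr {n k K t1 t2 u1 u2 : ℤ} (H : Ut n k K t1 t2 u1 u2) : Ut n k K t2 t1 u2 u1 := by
  unfold Ut at *; tauto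

lemma move_right {n k : ℤ} {p p' : Pic} {t1 t2 y1 y2 : ℤ} (hk : 2 ≤ k) (hL : Legal n k p p')
    (hA : Ag n k p p' t1 t2 y1 y2) (hV : y1 + 1 - t1 + k ≤ n)
    (hR : ¬ Rep n (k-1) k p (y1+1) y2) : Ag n k p p' t1 t2 (y1+1) y2 := by
  obtain ⟨h1, h2, h3⟩ := hA
  unfold Val at h1 h2
  have hv : Val n k k (y1+1-t1) (y2-t2) := by unfold Val; omega
  obtain ⟨w1, w2, hw, hb⟩ := hL _ _ hv
  have : w1 = y1 + 1 ∧ w2 = y2 := by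
    by_contra hne
    apply hR
    refine ⟨w1, w2, ?_, ?_, by omega⟩
    · unfold Val at hw ⊢; omega
    · intro i j a b c d
      have e1 := h3 (i+1) j (by omega) (by omega) c d
      have e2 := hb i j a (by omega) c d
      rw [show y1 + 1 + i = y1 + (i+1) by ring, ← e1, ← e2]
      congr 1; ring
  obtain ⟨rfl, rfl⟩ := this
  exact ⟨hw, hv, hb⟩

lemma move_left {n k : ℤ} {p p' : Pic} {t1 t2 y1 y2 : ℤ} (hk : 2 ≤ k) (hL : Legal n k p p')
    (hA : Ag n k p p' t1 t2 y1 y2) (hV : 0 ≤ y1 - 1 - t1)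
    (hR : ¬ Rep n (k-1) k p y1 y2) : Ag n k p p' t1 t2 (y1-1) y2 := by
  obtain ⟨h1, h2, h3⟩ := hA
  unfold Val at h1 h2
  have hv : Val n k k (y1-1-t1) (y2-t2) := by unfold Val; omega
  obtain ⟨w1, w2, hw, hb⟩ := hL _ _ hv
  have : w1 = y1 - 1 ∧ w2 = y2 := by
    by_contra hne
    apply hR
    refine ⟨w1 + 1, w2, ?_, ?_, by omega⟩
    · unfold Val at hw ⊢; omega
    · intro i j a b c d
      have e1 := h3 i j a (by omega) c d
      have e2 := hb (i+1) j (by omega) (by omega) c d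
      rw [show w1 + 1 + i = w1 + (i+1) by ring, ← e1, ← e2]
      congr 1; ring
  obtain ⟨rfl, rfl⟩ := this
  exact ⟨hw, hv, hb⟩

lemma row_all {n k K : ℤ} {p p' : Pic} {t1 t2 u1 b y0 : ℤ} (hk : 2 ≤ k) (hL : Legal n k p p')
    (hu : 0 ≤ u1 ∧ u1 + K + k ≤ n ∧ 0 ≤ u1 - t1 ∧ u1 - t1 + K + k ≤ n)
    (hf : RowFree n k K p u1 b) (h0 : u1 ≤ y0) (h0' : y0 ≤ u1 + K)
    (hA : Ag n k p p' t1 t2 y0 b) :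
    ∀ y, u1 ≤ y → y ≤ u1 + K → Ag n k p p' t1 t2 y b := by
  have hb := hA.1
  unfold Val at hb
  have up : ∀ y, y0 ≤ y → y ≤ u1 + K → Ag n k p p' t1 t2 y b := by
    intro y hy
    induction y, hy using Int.leInduction with
    | base => intro _; exact hA
    | succ y hy ih =>
      intro h
      exact move_right hk hL (ih (by omega)) (by omega)
        (hf _ (by omega) (by omega) (by unfold Val; omega))
  have down : ∀ y, y ≤ y0 → u1 ≤ y → Ag n k p p' t1 t2 y b := by
    intro y hy
    induction y, hy using Int.leInductionDown with
    | base => intro _; exact hA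
    | pred y hy ih =>
      intro h
      exact move_left hk hL (ih (by omega)) (by omega)
        (hf _ (by omega) (by omega) (by unfold Val; omega))
  intro y h1 h2
  rcases le_total y0 y with h | h
  · exact up y h h2
  · exact down y h h1

lemma RowFree_mono {n k K K' : ℤ} {p : Pic} {u1 u1' b : ℤ} (h : RowFree n k K p u1 b)
    (h1 : u1 ≤ u1') (h2 : u1' + K' ≤ u1 + K) : RowFree n k K' p u1' b :=
  fun z a b' c => h z (by omega) (by omega) c

lemma gd_of_row {n k K L : ℤ} {p p' : Pic} {t1 t2 u1 u2 b y0 : ℤ} (hk : 2 ≤ k) (hLK : L ≤ K)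
    (hL : Legal n k p p') (hE' : E1 n k K L (tr p))
    (hu : Ut n k K t1 t2 u1 u2)
    (hf : RowFree n k K p u1 b) (hb : u2 ≤ b) (hb' : b ≤ u2 + K)
    (h0 : u1 ≤ y0) (h0' : y0 ≤ u1 + K)
    (hA : Ag n k p p' t1 t2 y0 b) : Gd n k K p p' t1 t2 u1 u2 := by
  unfold Ut at hu
  have hrow := row_all hk hL ⟨hu.1, hu.2.1, hu.2.2.1, hu.2.2.2.1⟩ hf h0 h0' hA
  have hcol : ∀ a, u1 ≤ a → a ≤ u1 + K → RowFree n k K (tr p) u2 a →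
      ∀ y, u2 ≤ y → y ≤ u2 + K → Ag n k p p' t1 t2 a y := by
    intro a ha1 ha2 haf y hy1 hy2
    exact Ag_tr (row_all hk (Legal_tr hL)
      ⟨hu.2.2.2.2.1, hu.2.2.2.2.2.1, hu.2.2.2.2.2.2.1, hu.2.2.2.2.2.2.2⟩ haf hb hb'
      (Ag_tr (hrow a ha1 ha2)) y hy1 hy2)
  obtain ⟨a, ha1, ha2, haf⟩ := hE' u2 u1 (by omega) (by omega) (by omega) (by omega)
  have haf' : RowFree n k K (tr p) u2 a := RowFree_mono haf le_rfl (by omega)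
  refine ⟨?_, hcol⟩
  intro b' hb1 hb2 hbf
  exact row_all hk hL ⟨hu.1, hu.2.1, hu.2.2.1, hu.2.2.2.1⟩ hbf ha1 (by omega)
    (hcol a ha1 (by omega) haf' b' hb1 hb2)

lemma gd_step {n k K L : ℤ} {p p' : Pic} {t1 t2 u1 u2 : ℤ} (hk : 2 ≤ k) (hLK : L ≤ K) (hL0 : 0 < L)
    (hL : Legal n k p p') (hE : E1 n k K L p) (hE' : E1 n k K L (tr p))
    (hu : Ut n k K t1 t2 u1 u2) (hu' : Ut n k K t1 t2 (u1+1) u2) :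
    Gd n k K p p' t1 t2 u1 u2 ↔ Gd n k K p p' t1 t2 (u1+1) u2 := by
  have h1 := hu
  have h2 := hu'
  unfold Ut at h1 h2
  obtain ⟨b, hb1, hb2, hbf⟩ := hE u1 u2 (by omega) (by omega) (by omega) (by omega)
  have f1 : RowFree n k K p u1 b := RowFree_mono hbf le_rfl (by omega)
  have f2 : RowFree n k K p (u1+1) b := RowFree_mono hbf (by omega) (by omega)
  constructor
  · intro H
    exact gd_of_row hk hLK hL hE' hu' f2 hb1 (by omega) (le_refl (u1+1)) (by omega)
      (H.1 b hb1 (by omega) f1 _ (by omega) (by omega))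
  · intro H
    exact gd_of_row hk hLK hL hE' hu f1 hb1 (by omega) (show u1 ≤ u1+1 by omega) (by omega)
      (H.1 b hb1 (by omega) f2 _ (by omega) (by omega))

lemma gd_horiz {n k K L : ℤ} {p p' : Pic} {t1 t2 u1 v1 u2 : ℤ} (hk : 2 ≤ k) (hLK : L ≤ K)
    (hL0 : 0 < L)
    (hL : Legal n k p p') (hE : E1 n k K L p) (hE' : E1 n k K L (tr p))
    (hu : Ut n k K t1 t2 u1 u2) (hv : Ut n k K t1 t2 v1 u2) (huv : u1 ≤ v1) :
    Gd n k K p p' t1 t2 u1 u2 ↔ Gd n k K p p' t1 t2 v1 u2 := by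
  induction v1, huv using Int.leInduction with
  | base => rfl
  | succ y hy ih =>
    have hy' : Ut n k K t1 t2 y u2 := by unfold Ut at *; omega
    rw [ih hy', gd_step hk hLK hL0 hL hE hE' hy' hv]

lemma gd_horiz' {n k K L : ℤ} {p p' : Pic} {t1 t2 u1 v1 u2 : ℤ} (hk : 2 ≤ k) (hLK : L ≤ K)
    (hL0 : 0 < L)
    (hL : Legal n k p p') (hE : E1 n k K L p) (hE' : E1 n k K L (tr p))
    (hu : Ut n k K t1 t2 u1 u2) (hv : Ut n k K t1 t2 v1 u2)
    (H : Gd n k K p p' t1 t2 u1 u2) : Gd n k K p p' t1 t2 v1 u2 := by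
  rcases le_total u1 v1 with h | h
  · exact (gd_horiz hk hLK hL0 hL hE hE' hu hv h).1 H
  · exact (gd_horiz hk hLK hL0 hL hE hE' hv hu h).2 H

lemma gd_all {n k K L : ℤ} {p p' : Pic} {t1 t2 u1 v1 u2 v2 : ℤ} (hk : 2 ≤ k) (hLK : L ≤ K)
    (hL0 : 0 < L)
    (hL : Legal n k p p') (hE : E1 n k K L p) (hE' : E1 n k K L (tr p))
    (hu : Ut n k K t1 t2 u1 u2) (hv : Ut n k K t1 t2 v1 v2)
    (H : Gd n k K p p' t1 t2 u1 u2) : Gd n k K p p' t1 t2 v1 v2 := by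
  have hm : Ut n k K t1 t2 v1 u2 := by unfold Ut at *; omega
  have H1 := gd_horiz' hk hLK hL0 hL hE hE' hu hm H
  exact Gd_tr (gd_horiz' hk hLK hL0 (Legal_tr hL) hE' hE (Ut_tr hm) (Ut_tr hv) (Gd_tr H1))

/-- the shift vanishes -/
lemma shift_zero {n k K L : ℤ} {p p' : Pic} {t1 t2 u1 u2 : ℤ} (hk : 2 ≤ k) (hLK : L ≤ K)
    (hL0 : 0 < L)
    (hL : Legal n k p p') (hE : E1 n k K L p) (hE' : E1 n k K L (tr p))
    (hu : Ut n k K t1 t2 u1 u2) (ht : t1 + K + k ≤ n) (ht' : - t1 + K + k ≤ n)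
    (H : Gd n k K p p' t1 t2 u1 u2) : t1 = 0 := by
  have h1 := hu
  unfold Ut at h1
  rcases lt_trichotomy t1 0 with h | h | h
  · exfalso
    have hv : Ut n k K t1 t2 0 u2 := by unfold Ut; omega
    have H1 := gd_horiz' hk hLK hL0 hL hE hE' hu hv H
    obtain ⟨b, hb1, hb2, hbf⟩ := hE 0 u2 (by omega) (by omega) (by omega) (by omega)
    have f1 : RowFree n k K p 0 b := RowFree_mono hbf le_rfl (by omega)
    have A := H1.1 b hb1 (by omega) f1 0 le_rfl (by omega)
    have A2 := move_left hk hL A (by omega) (f1 0 le_rfl (by omega) (by unfold Val; omega))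
    have := A2.1.1
    omega
  · exact h
  · exfalso
    have hv : Ut n k K t1 t2 (n-k-K) u2 := by unfold Ut; omega
    have H1 := gd_horiz' hk hLK hL0 hL hE hE' hu hv H
    obtain ⟨b, hb1, hb2, hbf⟩ := hE (n-k-K) u2 (by omega) (by omega) (by omega) (by omega)
    have f1 : RowFree n k K p (n-k-K) b := RowFree_mono hbf le_rfl (by omega)
    have A := H1.1 b hb1 (by omega) f1 (n-k) (by omega) (by omega)
    have A2 := move_right hk hL A (by omega) (f1 _ (by omega) (by omega) (by unfold Val; omega))
    have := A2.1.2.1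
    omega

/-- no repetition in the window of size `s` at `u` -/
def NoRepW (n k s : ℤ) (p : Pic) (u1 u2 : ℤ) : Prop :=
  ∀ z1 z2, u1 ≤ z1 → z1 ≤ u1 + s → u2 ≤ z2 → z2 ≤ u2 + s → Val n (k-1) k z1 z2 →
    ¬ Rep n (k-1) k p z1 z2

lemma start {n k K L : ℤ} {p p' : Pic} {t1 t2 c1 c2 g : ℤ} (hk : 2 ≤ k) (hLK : L ≤ K)
    (hL0 : 0 < L)
    (hL : Legal n k p p') (hE' : E1 n k K L (tr p))
    (hn : 4 * K + 4 * k + 20 ≤ n)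
    (hc1 : n - k ≤ 2 * c1 + 2 ∧ 2 * c1 ≤ n - k) (hc2 : n - k ≤ 2 * c2 + 2 ∧ 2 * c2 ≤ n - k)
    (hg : n ≤ 2 * g + 2 ∧ 2 * g ≤ n)
    (hW : NoRepW n k (2*K+2*k+10) p (g-K-k-4) (g-K-k-4))
    (hA : Ag n k p p' t1 t2 c1 c2) :
    ∃ u1 u2, Ut n k K t1 t2 u1 u2 ∧ Gd n k K p p' t1 t2 u1 u2 ∧
      t1 + K + k ≤ n ∧ -t1 + K + k ≤ n ∧ t2 + K + k ≤ n ∧ -t2 + K + k ≤ n := by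
  obtain ⟨hv1, hv2, -⟩ := id hA
  unfold Val at hv1 hv2
  obtain ⟨u1, h1, h1', h1_pp, h1_ppp⟩ : ∃ u1, u1 ≤ c1 ∧ c1 ≤ u1 + K ∧ 0 ≤ u1 - t1 ∧
      u1 - t1 + K + k ≤ n := by
    by_cases h : c1 - t1 + K + k ≤ n
    · exact ⟨c1, by omega, by omega, by omega, by omega⟩
    · exact ⟨c1 - K, by omega, by omega, by omega, by omega⟩
  obtain ⟨u2, h2, h2', h2_pp, h2_ppp⟩ : ∃ u2, u2 ≤ c2 ∧ c2 ≤ u2 + K ∧ 0 ≤ u2 - t2 ∧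
      u2 - t2 + K + k ≤ n := by
    by_cases h : c2 - t2 + K + k ≤ n
    · exact ⟨c2, by omega, by omega, by omega, by omega⟩
    · exact ⟨c2 - K, by omega, by omega, by omega, by omega⟩
  have hu : Ut n k K t1 t2 u1 u2 := by unfold Ut; omega
  refine ⟨u1, u2, hu, ?_, by omega, by omega, by omega, by omega⟩
  refine gd_of_row hk hLK hL hE' hu (b := c2) (y0 := c1) ?_ h2 h2' h1 h1' hA
  intro z hz1 hz2 hz3
  exact hW z c2 (by omega) (by omega) (by omega) (by omega) hz3

end RP

namespace RP

def NoNear (n k D : ℤ) (p : Pic) : Prop :=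
  ∀ z1 z2 w1 w2, Val n (k-1) k z1 z2 → Val n (k-1) k w1 w2 → (w1 ≠ z1 ∨ w2 ≠ z2) →
    Beq (k-1) k p p z1 z2 w1 w2 → Far D z1 z2 w1 w2

/-- the two-dimensional walk of boxes next to an extremal disagreement -/
def E2 (n k D : ℤ) (p : Pic) (i0 c r : ℤ) : Prop :=
  0 ≤ c ∧ c + k ≤ n ∧ 0 ≤ r ∧ r + 2 * k - 1 ≤ n ∧ ∃ w1 w2 : ℤ → ℤ, ∀ a, 0 ≤ a → a < k →
    Val n k k (w1 a) (w2 a) ∧ Far D c (r + a) (w1 a) (w2 a) ∧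
    (∀ i j, 0 ≤ i → i < k → 0 ≤ j → j < k → i ≠ i0 →
      p (c + i) (r + a + j) = p (w1 a + i) (w2 a + j)) ∧
    (a + 1 < k → ∀ i j, 0 ≤ i → i < k → 0 ≤ j → j < k - 1 →
      p (w1 a + i) (w2 a + 1 + j) = p (w1 (a+1) + i) (w2 (a+1) + j))

lemma ext_R {n k D : ℤ} {p p' : Pic} (hk : 2 ≤ k) (hL : Legal n k p p') (h0 : NoNear n k D p)
    {a b c d : ℤ} (ha : 0 ≤ a) (hb : b ≤ n) (hc : 0 ≤ c) (hd : d ≤ n)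
    (hr : ∀ i j, b - k ≤ i → i < b → c ≤ j → j < d → p' i j = p i j)
    (ht : ∀ i j, a ≤ i → i < b → c ≤ j → j < c + k → p' i j = p i j)
    (hbo : ∀ i j, a ≤ i → i < b → d - k ≤ j → j < d → p' i j = p i j)
    {v1 v2 : ℤ} (hv : a ≤ v1 ∧ v1 < b ∧ c ≤ v2 ∧ v2 < d) (hne : p' v1 v2 ≠ p v1 v2) :
    ∃ c0 r0, a ≤ c0 ∧ c0 + k < b ∧ c + k ≤ r0 ∧ r0 + k < d ∧ p' c0 r0 ≠ p c0 r0 ∧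
      (∀ i j, a ≤ i → i < b → c ≤ j → j < d → p' i j ≠ p i j → i ≤ c0) ∧
      E2 n k D p 0 c0 (r0 - k + 1) := by
  obtain ⟨c0, ⟨h1, h2, r0, h3, h4, h5⟩, hmax⟩ := Int.exists_greatest_of_bdd
    (P := fun i => a ≤ i ∧ i < b ∧ ∃ j, c ≤ j ∧ j < d ∧ p' i j ≠ p i j)
    ⟨b, fun z hz => by omega⟩ ⟨v1, hv.1, hv.2.1, v2, hv.2.2.1, hv.2.2.2, hne⟩
  have hmax' : ∀ i j, a ≤ i → i < b → c ≤ j → j < d → p' i j ≠ p i j → i ≤ c0 :=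
    fun i j x1 x2 x3 x4 x5 => hmax i ⟨x1, x2, j, x3, x4, x5⟩
  have hag : ∀ i j, c0 < i → i < b → c ≤ j → j < d → p' i j = p i j := by
    intro i j x1 x2 x3 x4
    by_contra hcon
    have := hmax' i j (by omega) x2 x3 x4 hcon
    omega
  have g1 : c0 < b - k := by
    by_contra hcon; exact h5 (hr _ _ (by omega) h2 h3 h4)
  have g2 : c + k ≤ r0 := by
    by_contra hcon; exact h5 (ht _ _ h1 h2 h3 (by omega))
  have g3 : r0 < d - k := by
    by_contra hcon; exact h5 (hbo _ _ h1 h2 (by omega) h4)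
  refine ⟨c0, r0, h1, by omega, g2, by omega, h5, hmax', by omega, by omega, by omega, by omega, ?_⟩
  have hval : ∀ α, 0 ≤ α → α < k → Val n k k c0 (r0 - k + 1 + α) := by
    intro α _ _; unfold Val; omega
  have hex : ∀ α, ∃ y : ℤ × ℤ, 0 ≤ α → α < k → Val n k k y.1 y.2 ∧
      Beq k k p' p c0 (r0 - k + 1 + α) y.1 y.2 := by
    intro α
    by_cases hα : 0 ≤ α ∧ α < k
    · obtain ⟨y1, y2, h⟩ := hL _ _ (hval α hα.1 hα.2)
      exact ⟨(y1, y2), fun _ _ => h⟩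
    · exact ⟨(0,0), fun h h' => absurd ⟨h, h'⟩ hα⟩
  choose w hw using hex
  refine ⟨fun α => (w α).1, fun α => (w α).2, ?_⟩
  intro α hα0 hαk
  obtain ⟨hv, hbq⟩ := hw α hα0 hαk
  have e2 : ∀ i j, 0 ≤ i → i < k → 0 ≤ j → j < k → i ≠ 0 →
      p (c0 + i) (r0 - k + 1 + α + j) = p ((w α).1 + i) ((w α).2 + j) := by
    intro i j x1 x2 x3 x4 x5
    rw [← hbq i j x1 x2 x3 x4]
    exact (hag _ _ (by omega) (by omega) (by omega) (by omega)).symm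
  refine ⟨hv, ?_, e2, ?_⟩
  · have hneq : (w α).1 ≠ c0 ∨ (w α).2 ≠ r0 - k + 1 + α := by
      by_contra hcon
      push Not at hcon
      have := hbq 0 (k - 1 - α) le_rfl (by omega) (by omega) (by omega)
      rw [hcon.1, hcon.2] at this
      apply h5
      convert this using 2 <;> ring
    have := h0 (c0+1) (r0 - k + 1 + α) ((w α).1 + 1) (w α).2
      (by have := hval α hα0 hαk; unfold Val at *; omega) (by unfold Val at *; omega) (by omega) ?_
    · beta_reduce; unfold Far at *; omega
    · intro i j x1 x2 x3 x4
      have := e2 (i+1) j (by omega) (by omega) x3 x4 (by omega)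
      rw [show c0 + 1 + i = c0 + (i+1) by ring, this]
      congr 1; ring
  · intro hα1 i j x1 x2 x3 x4
    have q1 := hbq i (j+1) x1 x2 (by omega) (by omega)
    have q2 := (hw (α+1) (by omega) hα1).2 i j x1 x2 x3 (by omega)
    show p ((w α).1 + i) ((w α).2 + 1 + j) = p ((w (α+1)).1 + i) ((w (α+1)).2 + j)
    rw [← q2, show (w α).2 + 1 + j = (w α).2 + (j+1) by ring, ← q1]
    congr 1; ring

lemma NoNear_flp {n k D : ℤ} {p : Pic} (h : NoNear n k D p) : NoNear n k D (flp n p) := by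
  intro z1 z2 w1 w2 hz hw hne hb
  have := h (n - (k-1) - z1) z2 (n - (k-1) - w1) w2 (by unfold Val at *; omega)
    (by unfold Val at *; omega) (by omega) ?_
  · unfold Far at *; omega
  · intro i j x1 x2 x3 x4
    have := hb (k - 1 - 1 - i) j (by omega) (by omega) x3 x4
    unfold flp at this
    convert this using 2 <;> ring

lemma Legal_flp {n k : ℤ} {p p' : Pic} (h : Legal n k p p') : Legal n k (flp n p) (flp n p') := by
  intro x1 x2 hx
  obtain ⟨y1, y2, hy, hb⟩ := h (n - k - x1) x2 (by unfold Val at *; omega)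
  refine ⟨n - k - y1, y2, by unfold Val at *; omega, ?_⟩
  intro i j x1 x2 x3 x4
  have := hb (k - 1 - i) j (by omega) (by omega) x3 x4
  unfold flp
  convert this using 2 <;> ring

lemma E2_flp {n k D : ℤ} {p : Pic} {c r : ℤ} (h : E2 n k D (flp n p) 0 c r) :
    E2 n k D p (k-1) (n - k - c) r := by
  obtain ⟨h1, h2, h3, h4, w1, w2, hw⟩ := h
  refine ⟨by omega, by omega, h3, h4, fun a => n - k - w1 a, w2, ?_⟩
  intro a ha1 ha2
  obtain ⟨g1, g2, g3, g4⟩ := hw a ha1 ha2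
  refine ⟨by beta_reduce; unfold Val at *; omega, by beta_reduce; unfold Far at *; omega, ?_, ?_⟩
  · intro i j x1 x2 x3 x4 x5
    have := g3 (k - 1 - i) j (by omega) (by omega) x3 x4 (by omega)
    unfold flp at this
    convert this using 2 <;> ring
  · intro ha i j x1 x2 x3 x4
    have := g4 ha (k - 1 - i) j (by omega) (by omega) x3 x4
    unfold flp at this
    convert this using 2 <;> ring

lemma ext_L {n k D : ℤ} {p p' : Pic} (hk : 2 ≤ k) (hL : Legal n k p p') (h0 : NoNear n k D p)
    {a b c d : ℤ} (ha : 0 ≤ a) (hb : b ≤ n) (hc : 0 ≤ c) (hd : d ≤ n)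
    (hr : ∀ i j, a ≤ i → i < a + k → c ≤ j → j < d → p' i j = p i j)
    (ht : ∀ i j, a ≤ i → i < b → c ≤ j → j < c + k → p' i j = p i j)
    (hbo : ∀ i j, a ≤ i → i < b → d - k ≤ j → j < d → p' i j = p i j)
    {v1 v2 : ℤ} (hv : a ≤ v1 ∧ v1 < b ∧ c ≤ v2 ∧ v2 < d) (hne : p' v1 v2 ≠ p v1 v2) :
    ∃ c0 r0, a + k ≤ c0 ∧ c0 < b ∧ c + k ≤ r0 ∧ r0 + k < d ∧ p' c0 r0 ≠ p c0 r0 ∧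
      E2 n k D p (k-1) (c0 - k + 1) (r0 - k + 1) := by
  obtain ⟨c0, r0, h1, h2, h3, h4, h5, -, h6⟩ := ext_R (p := flp n p) (p' := flp n p') (D := D)
    (a := n - b) (b := n - a) (c := c) (d := d) (v1 := n - 1 - v1) (v2 := v2)
    hk (Legal_flp hL) (NoNear_flp h0) (by omega) (by omega) hc hd
    (fun i j x1 x2 x3 x4 => hr _ _ (by omega) (by omega) x3 x4)
    (fun i j x1 x2 x3 x4 => ht _ _ (by omega) (by omega) x3 x4)
    (fun i j x1 x2 x3 x4 => hbo _ _ (by omega) (by omega) x3 x4) (by omega)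
    (by unfold flp; convert hne using 2 <;> ring)
  refine ⟨n - 1 - c0, r0, by omega, by omega, h3, h4, h5, ?_⟩
  have := E2_flp h6
  convert this using 1; ring

structure Good (n k K L D : ℤ) (p : Pic) : Prop where
  noNear : NoNear n k D p
  e1 : E1 n k K L p
  left : ∀ c r, c < 5 * L → ¬ E2 n k D p 0 c r
  right : ∀ c r, n - 5 * L < c → ¬ E2 n k D p (k-1) c r
  pair : ∀ c r c' r', c' + k - 1 ≤ c → c < c' + 6 * L → r < r' + 6 * L → r' < r + 6 * L →
    ¬ (E2 n k D p 0 c r ∧ E2 n k D p (k-1) c' r')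
  norep : ∀ u1 u2, (u1 = 0 ∨ u1 = n / 2 - K - k - 4 ∨ u1 = n - k - K) →
    (u2 = 0 ∨ u2 = n / 2 - K - k - 4 ∨ u2 = n - k - K) → NoRepW n k (2*K+2*k+10) p u1 u2

def AllGd (n k K : ℤ) (p p' : Pic) : Prop :=
  ∀ u1 u2, 0 ≤ u1 → u1 + K + k ≤ n → 0 ≤ u2 → u2 + K + k ≤ n → Gd n k K p p' 0 0 u1 u2

lemma Ag_cell {n k : ℤ} {p p' : Pic} {y1 y2 i j : ℤ} (h : Ag n k p p' 0 0 y1 y2)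
    (h1 : y1 ≤ i) (h2 : i < y1 + k) (h3 : y2 ≤ j) (h4 : j < y2 + k) : p' i j = p i j := by
  have := h.2.2 (i - y1) (j - y2) (by omega) (by omega) (by omega) (by omega)
  convert this using 2 <;> ring

lemma row_strip {n k K : ℤ} {p p' : Pic} {u1 u2 b : ℤ} (hk : 2 ≤ k) (hK : 0 ≤ K)
    (H : Gd n k K p p' 0 0 u1 u2)
    (hb : u2 ≤ b) (hb' : b ≤ u2 + K) (hf : RowFree n k (K+1) p u1 b) :
    ∀ i j, u1 ≤ i → i < u1 + K + k → b ≤ j → j < b + k → p' i j = p i j := by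
  intro i j h1 h2 h3 h4
  have hf' : RowFree n k K p u1 b := RowFree_mono hf le_rfl (by omega)
  by_cases h : i ≤ u1 + K
  · exact Ag_cell (H.1 b hb hb' hf' i h1 h) le_rfl (by omega) h3 h4
  · exact Ag_cell (H.1 b hb hb' hf' (u1+K) (by omega) (by omega)) (by omega) (by omega) h3 h4

lemma col_strip {n k K : ℤ} {p p' : Pic} {u1 u2 b : ℤ} (hk : 2 ≤ k) (hK : 0 ≤ K)
    (H : Gd n k K p p' 0 0 u1 u2)
    (hb : u1 ≤ b) (hb' : b ≤ u1 + K) (hf : RowFree n k (K+1) (tr p) u2 b) :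
    ∀ i j, b ≤ i → i < b + k → u2 ≤ j → j < u2 + K + k → p' i j = p i j :=
  fun i j h1 h2 h3 h4 => row_strip hk hK (Gd_tr H) hb hb' hf j i h3 h4 h1 h2

lemma side {n k K L D : ℤ} {p p' : Pic} (hk : 2 ≤ k) (hK : K = 4 * L) (hkL : k ≤ L)
    (hn : 20 * L ≤ n) (hL : Legal n k p p') (hG : Good n k K L D p) (hG' : Good n k K L D (tr p))
    (hA : AllGd n k K p p') {v1 v2 : ℤ} (h0 : 0 ≤ v1) (h1 : v1 < n) 
    (hv1 : v1 < 3 * L ∨ n - 1 - 3 * L < v1) (hv2 : 3 * L ≤ v2) (hv2' : v2 ≤ n - 1 - 3 * L) :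
    p' v1 v2 = p v1 v2 := by
  by_contra hne
  rcases hv1 with hv1 | hv1
  · have G := hA 0 (v2 - 2 * L) le_rfl (by omega) (by omega) (by omega)
    obtain ⟨xR, hx1, hx2, hxf⟩ := hG'.e1 (v2 - 2 * L) (3*L) (by omega) (by omega) (by omega) (by omega)
    obtain ⟨yT, hy1, hy2, hyf⟩ := hG.e1 0 (v2 - 2 * L) (by omega) (by omega) (by omega) (by omega)
    obtain ⟨yB, hz1, hz2, hzf⟩ := hG.e1 0 (v2 + L) (by omega) (by omega) (by omega) (by omega)
    have s1 := col_strip hk (by omega) G (by omega) (by omega) hxf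
    have s2 := row_strip hk (by omega) G (by omega) (by omega) hyf
    have s3 := row_strip hk (by omega) G (by omega) (by omega) hzf
    obtain ⟨c0, r0, g1, g2, g3, g4, g5, -, g6⟩ := ext_R (D := D) (a := 0) (b := xR + k) (c := yT)
      (d := yB + k) (v1 := v1) (v2 := v2)
      hk hL hG.noNear le_rfl (by omega) (by omega) (by omega)
      (fun i j x1 x2 x3 x4 => s1 _ _ (by omega) (by omega) (by omega) (by omega))
      (fun i j x1 x2 x3 x4 => s2 _ _ (by omega) (by omega) (by omega) (by omega))
      (fun i j x1 x2 x3 x4 => s3 _ _ (by omega) (by omega) (by omega) (by omega)) (by omega) hne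
    exact hG.left _ _ (by omega) g6
  · have G := hA (n - k - K) (v2 - 2 * L) (by omega) (by omega) (by omega) (by omega)
    obtain ⟨xL, hx1, hx2, hxf⟩ := hG'.e1 (v2 - 2 * L) (n-k-K) (by omega) (by omega) (by omega) (by omega)
    obtain ⟨yT, hy1, hy2, hyf⟩ := hG.e1 (n-k-K) (v2 - 2 * L) (by omega) (by omega) (by omega) (by omega)
    obtain ⟨yB, hz1, hz2, hzf⟩ := hG.e1 (n-k-K) (v2 + L) (by omega) (by omega) (by omega) (by omega)
    have s1 := col_strip hk (by omega) G (by omega) (by omega) hxf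
    have s2 := row_strip hk (by omega) G (by omega) (by omega) hyf
    have s3 := row_strip hk (by omega) G (by omega) (by omega) hzf
    obtain ⟨c0, r0, g1, g2, g3, g4, g5, g6⟩ := ext_L (D := D) (a := xL) (b := n) (c := yT)
      (d := yB + k) (v1 := v1) (v2 := v2)
      hk hL hG.noNear (by omega) le_rfl (by omega) (by omega)
      (fun i j x1 x2 x3 x4 => s1 _ _ (by omega) (by omega) (by omega) (by omega))
      (fun i j x1 x2 x3 x4 => s2 _ _ (by omega) (by omega) (by omega) (by omega))
      (fun i j x1 x2 x3 x4 => s3 _ _ (by omega) (by omega) (by omega) (by omega)) (by omega) hne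
    exact hG.right _ _ (by omega) g6

lemma middle {n k K L D : ℤ} {p p' : Pic} (hk : 2 ≤ k) (hK : K = 4 * L) (hkL : k ≤ L)
    (hn : 20 * L ≤ n) (hL : Legal n k p p') (hG : Good n k K L D p) (hG' : Good n k K L D (tr p))
    (hA : AllGd n k K p p') {v1 v2 : ℤ} 
    (hv1 : 3 * L ≤ v1) (hv1' : v1 ≤ n - 1 - 3 * L) (hv2 : 3 * L ≤ v2) (hv2' : v2 ≤ n - 1 - 3 * L) :
    p' v1 v2 = p v1 v2 := by
  by_contra hne
  have G := hA (v1 - 2 * L) (v2 - 2 * L) (by omega) (by omega) (by omega) (by omega)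
  obtain ⟨xL, hw1, hw2, hwf⟩ := hG'.e1 (v2 - 2 * L) (v1 - 2 * L) (by omega) (by omega) (by omega) (by omega)
  obtain ⟨xR, hx1, hx2, hxf⟩ := hG'.e1 (v2 - 2 * L) (v1 + L) (by omega) (by omega) (by omega) (by omega)
  obtain ⟨yT, hy1, hy2, hyf⟩ := hG.e1 (v1 - 2 * L) (v2 - 2 * L) (by omega) (by omega) (by omega) (by omega)
  obtain ⟨yB, hz1, hz2, hzf⟩ := hG.e1 (v1 - 2 * L) (v2 + L) (by omega) (by omega) (by omega) (by omega)
  have s0 := col_strip hk (by omega) G (by omega) (by omega) hwf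
  have s1 := col_strip hk (by omega) G (by omega) (by omega) hxf
  have s2 := row_strip hk (by omega) G (by omega) (by omega) hyf
  have s3 := row_strip hk (by omega) G (by omega) (by omega) hzf
  obtain ⟨c0, r0, g1, g2, g3, g4, g5, gm, g6⟩ := ext_R (D := D) (a := xL) (b := xR + k) (c := yT)
      (d := yB + k) (v1 := v1) (v2 := v2)
      hk hL hG.noNear (by omega) (by omega) (by omega) (by omega)
      (fun i j x1 x2 x3 x4 => s1 _ _ (by omega) (by omega) (by omega) (by omega))
      (fun i j x1 x2 x3 x4 => s2 _ _ (by omega) (by omega) (by omega) (by omega))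
      (fun i j x1 x2 x3 x4 => s3 _ _ (by omega) (by omega) (by omega) (by omega)) (by omega) hne
  obtain ⟨c1, r1, f1, f2, f3, f4, f5, f6⟩ := ext_L (D := D) (a := xL) (b := xR + k) (c := yT)
      (d := yB + k) (v1 := v1) (v2 := v2)
      hk hL hG.noNear (by omega) (by omega) (by omega) (by omega)
      (fun i j x1 x2 x3 x4 => s0 _ _ (by omega) (by omega) (by omega) (by omega))
      (fun i j x1 x2 x3 x4 => s2 _ _ (by omega) (by omega) (by omega) (by omega))
      (fun i j x1 x2 x3 x4 => s3 _ _ (by omega) (by omega) (by omega) (by omega)) (by omega) hne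
  have := gm c1 r1 (by omega) (by omega) (by omega) (by omega) f5
  exact hG.pair _ _ _ _ (by omega) (by omega) (by omega) (by omega) ⟨g6, f6⟩

lemma corner {n k K L D : ℤ} {p p' : Pic} (hk : 2 ≤ k) (hK : K = 4 * L) (hkL : k ≤ L)
    (hn : 20 * L ≤ n) (hG : Good n k K L D p) 
    (hA : AllGd n k K p p') {v1 v2 : ℤ} (h0 : 0 ≤ v1) (h1 : v1 < n) (h0' : 0 ≤ v2) (h1' : v2 < n) 
    (hv1 : v1 < 3 * L ∨ n - 1 - 3 * L < v1) (hv2 : v2 < 3 * L ∨ n - 1 - 3 * L < v2) :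
    p' v1 v2 = p v1 v2 := by
  obtain ⟨u1, hu1, hu1', hu1_pp, x1, hx1, hx1', hx1_pp, hx1_ppp⟩ : ∃ u1, (u1 = 0 ∨ u1 = n - k - K) ∧ 0 ≤ u1 ∧ u1 + K + k ≤ n ∧
      ∃ x1, u1 ≤ x1 ∧ x1 ≤ u1 + K ∧ x1 ≤ v1 ∧ v1 < x1 + k := by
    rcases hv1 with h | h
    · exact ⟨0, Or.inl rfl, by omega, by omega, v1, by omega, by omega, by omega, by omega⟩
    · by_cases hh : v1 ≤ n - k
      · exact ⟨n-k-K, Or.inr rfl, by omega, by omega, v1, by omega, by omega, by omega, by omega⟩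
      · exact ⟨n-k-K, Or.inr rfl, by omega, by omega, n-k, by omega, by omega, by omega, by omega⟩
  obtain ⟨u2, hu2, hu2', hu2_pp, x2, hx2, hx2', hx2_pp, hx2_ppp⟩ : ∃ u2, (u2 = 0 ∨ u2 = n - k - K) ∧ 0 ≤ u2 ∧ u2 + K + k ≤ n ∧
      ∃ x2, u2 ≤ x2 ∧ x2 ≤ u2 + K ∧ x2 ≤ v2 ∧ v2 < x2 + k := by
    rcases hv2 with h | h
    · exact ⟨0, Or.inl rfl, by omega, by omega, v2, by omega, by omega, by omega, by omega⟩
    · by_cases hh : v2 ≤ n - k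
      · exact ⟨n-k-K, Or.inr rfl, by omega, by omega, v2, by omega, by omega, by omega, by omega⟩
      · exact ⟨n-k-K, Or.inr rfl, by omega, by omega, n-k, by omega, by omega, by omega, by omega⟩
  have G := hA u1 u2 hu1' hu1_pp hu2' hu2_pp
  have W := hG.norep u1 u2 (by tauto) (by tauto)
  exact Ag_cell (G.1 x2 hx2 hx2' (fun z a b c => W z x2 (by omega) (by omega) (by omega) (by omega) c)
    x1 hx1 hx1') hx1_pp hx1_ppp hx2_pp hx2_ppp

lemma AllGd_tr {n k K : ℤ} {p p' : Pic} (h : AllGd n k K p p') : AllGd n k K (tr p) (tr p') :=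
  fun u1 u2 h1 h2 h3 h4 => Gd_tr (h u2 u1 h3 h4 h1 h2)

theorem determ {n k K L D : ℤ} {p p' : Pic} (hk : 2 ≤ k) (hK : K = 4 * L) (hkL : k ≤ L)
    (hn : 30 * L + 30 ≤ n) (hL : Legal n k p p') (hG : Good n k K L D p)
    (hG' : Good n k K L D (tr p)) {t1 t2 c1 c2 : ℤ}
    (hc1 : n - k ≤ 2 * c1 + 2 ∧ 2 * c1 ≤ n - k) (hc2 : n - k ≤ 2 * c2 + 2 ∧ 2 * c2 ≤ n - k)
    (hA : Ag n k p p' t1 t2 c1 c2) :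
    ∀ i j, 0 ≤ i → i < n → 0 ≤ j → j < n → p' i j = p i j := by
  obtain ⟨u1, u2, hu, hg, b1, b2, b3, b4⟩ := start hk (show L ≤ K by omega) (by omega) hL hG'.e1
    (by omega) hc1 hc2 (g := n / 2) (by omega) (hG.norep _ _ (by tauto) (by tauto)) hA
  obtain rfl := shift_zero hk (show L ≤ K by omega) (by omega) hL hG.e1 hG'.e1 hu b1 b2 hg
  obtain rfl := shift_zero hk (show L ≤ K by omega) (by omega) (Legal_tr hL) hG'.e1
    hG.e1 (Ut_tr hu) b3 b4 (Gd_tr hg)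
  have hAll : AllGd n k K p p' := fun v1 v2 h1 h2 h3 h4 =>
    gd_all hk (show L ≤ K by omega) (by omega) hL hG.e1 hG'.e1 hu (by unfold Ut; omega) hg
  intro i j hi hi' hj hj'
  by_cases h1 : i < 3 * L ∨ n - 1 - 3 * L < i
  · by_cases h2 : j < 3 * L ∨ n - 1 - 3 * L < j
    · exact corner hk hK hkL (by omega) hG hAll hi hi' hj hj' h1 h2
    · exact side hk hK hkL (by omega) hL hG hG' hAll hi hi' h1 (by omega) (by omega)
  · by_cases h2 : j < 3 * L ∨ n - 1 - 3 * L < j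
    · exact side (p := tr p) (p' := tr p') hk hK hkL (by omega) (Legal_tr hL) hG' hG
        (AllGd_tr hAll) hj hj' h2 (by omega) (by omega)
    · exact middle hk hK hkL (by omega) hL hG hG' hAll (by omega) (by omega) (by omega) (by omega)

end RP

namespace RP

/-! ### Counting -/

noncomputable def sq (n : ℕ) : Finset (ℤ × ℤ) := Finset.Ico (0:ℤ) n ×ˢ Finset.Ico (0:ℤ) n

lemma card_sq (n : ℕ) : (sq n).card = n ^ 2 := by
  simp [sq, Finset.card_product]; ring

lemma mem_sq {n : ℕ} {x : ℤ × ℤ} : x ∈ sq n ↔ 0 ≤ x.1 ∧ x.1 < n ∧ 0 ≤ x.2 ∧ x.2 < n := by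
  simp [sq]; tauto

/-- the picture on `ℤ × ℤ` attached to a picture of size `n` -/
def ext {n : ℕ} (P : Fin n × Fin n → Bool) : Pic := fun i j =>
  if h : (0 ≤ i ∧ i < n) ∧ (0 ≤ j ∧ j < n) then
    P (⟨i.toNat, by omega⟩, ⟨j.toNat, by omega⟩) else false

lemma ext_coe {n : ℕ} (P : Fin n × Fin n → Bool) (a b : Fin n) :
    ext P (a : ℕ) (b : ℕ) = P (a, b) := by
  unfold ext
  rw [dif_pos (by omega)]
  congr 1

lemma ext_nat {n : ℕ} (P : Fin n × Fin n → Bool) (a b : ℕ) (ha : a < n) (hb : b < n) :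
    ext P (a : ℤ) (b : ℤ) = P (⟨a, ha⟩, ⟨b, hb⟩) := ext_coe P ⟨a, ha⟩ ⟨b, hb⟩

lemma ext_out {n : ℕ} (P : Fin n × Fin n → Bool) (x : ℤ × ℤ) (hx : x ∉ sq n) :
    ext P x.1 x.2 = false := by
  unfold ext
  rw [dif_neg]
  rw [mem_sq] at hx; tauto

lemma ext_inj {n : ℕ} {P P' : Fin n × Fin n → Bool}
    (h : ∀ i j, 0 ≤ i → i < (n:ℤ) → 0 ≤ j → j < (n:ℤ) → ext P i j = ext P' i j) : P = P' := by
  funext ⟨a, b⟩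
  rw [← ext_coe P, ← ext_coe P']
  exact h _ _ (by omega) (by omega) (by omega) (by omega)

open scoped Classical in
/-- probability of an event -/
noncomputable def pr (n : ℕ) (E : Pic → Prop) : ℝ :=
  (Finset.univ.filter fun P : Fin n × Fin n → Bool => E (ext P)).card / 2 ^ (n ^ 2)

lemma pr_nonneg (n : ℕ) (E : Pic → Prop) : 0 ≤ pr n E := by unfold pr; positivity

lemma pr_mono {n : ℕ} {E F : Pic → Prop} (h : ∀ p, E p → F p) : pr n E ≤ pr n F := by
  classical
  unfold pr
  gcongr
  intro hx
  exact h _ hx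

lemma pr_or {n : ℕ} {G E F : Pic → Prop} (h : ∀ p, G p → E p ∨ F p) :
    pr n G ≤ pr n E + pr n F := by
  classical
  unfold pr
  rw [← add_div]
  gcongr
  have : (Finset.univ.filter fun P : Fin n × Fin n → Bool => G (ext P)) ⊆
      (Finset.univ.filter fun P : Fin n × Fin n → Bool => E (ext P)) ∪
      (Finset.univ.filter fun P : Fin n × Fin n → Bool => F (ext P)) := by
    intro P hP
    simpa using h _ (Finset.mem_filter.1 hP).2
  exact_mod_cast (Finset.card_le_card this).trans (Finset.card_union_le _ _)

lemma pr_union {n : ℕ} {ι : Type*} (I : Finset ι) (E : ι → Pic → Prop) (b : ℝ) {G : Pic → Prop}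
    (hG : ∀ p, G p → ∃ i ∈ I, E i p)
    (h : ∀ i ∈ I, pr n (E i) ≤ b) : pr n G ≤ I.card * b := by
  classical
  have h1 : pr n G ≤ ∑ i ∈ I, pr n (E i) := by
    unfold pr
    rw [← Finset.sum_div]
    gcongr
    have : (Finset.univ.filter fun P : Fin n × Fin n → Bool =>
        G (ext P)) ⊆
        I.biUnion (fun i => Finset.univ.filter fun P : Fin n × Fin n → Bool => E i (ext P)) := by
      intro P hP
      simpa using hG _ (Finset.mem_filter.1 hP).2
    exact_mod_cast (Finset.card_le_card this).trans Finset.card_biUnion_le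
  refine h1.trans ((Finset.sum_le_sum h).trans ?_)
  simp

lemma ext_tr {n : ℕ} (P : Fin n × Fin n → Bool) : ext (fun x => P (x.2, x.1)) = tr (ext P) := by
  funext i j
  unfold tr ext
  by_cases h : (0 ≤ i ∧ i < (n:ℤ)) ∧ (0 ≤ j ∧ j < (n:ℤ))
  · rw [dif_pos h, dif_pos h.symm]
  · rw [dif_neg h, dif_neg (fun h' => h h'.symm)]

lemma pr_tr (n : ℕ) (E : Pic → Prop) : pr n (fun p => E (tr p)) = pr n E := by
  classical
  unfold pr
  congr 2
  refine Finset.card_bij' (fun P _ => fun x => P (x.2, x.1)) (fun P _ => fun x => P (x.2, x.1))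
    ?_ ?_ ?_ ?_
  · intro P hP; simp only [Finset.mem_filter, Finset.mem_univ, true_and] at *; rwa [ext_tr]
  · intro P hP; simp only [Finset.mem_filter, Finset.mem_univ, true_and] at *; rw [ext_tr]; exact hP
  · intro P hP; rfl
  · intro P hP; rfl

theorem key (n : ℕ) (S : Finset (ℤ × ℤ)) (hS : S ⊆ sq n) {ω : Type*} (W : Pic → Finset ω) (N : ℕ)
    (E : Pic → Prop) (R : Pic → ω → Prop)
    (hN : ∀ p, E p → (W p).card ≤ N)
    (hW : ∀ p p' : Pic, (∀ x : ℤ × ℤ, x ∉ S → p x.1 x.2 = p' x.1 x.2) → W p = W p')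
    (hE : ∀ p, E p → ∃ w ∈ W p, R p w)
    (hR : ∀ (p p' : Pic) w, w ∈ W p → R p w → R p' w →
      (∀ x : ℤ × ℤ, x ∉ S → p x.1 x.2 = p' x.1 x.2) → ∀ x ∈ S, p x.1 x.2 = p' x.1 x.2) :
    pr n E ≤ N / 2 ^ S.card := by
  classical
  let c : Fin n × Fin n → ℤ × ℤ := fun x => ((x.1 : ℕ), (x.2 : ℕ))
  have hcinj : Function.Injective c := by
    intro x y h
    simp only [c, Prod.mk.injEq, Nat.cast_inj] at h
    ext
    · exact h.1
    · exact h.2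
  let ρ : (Fin n × Fin n → Bool) → ({x : Fin n × Fin n // c x ∉ S} → Bool) := fun P x => P x.1
  set B := Finset.univ.filter fun P : Fin n × Fin n → Bool => E (ext P) with hB
  have hoff : ∀ P P', ρ P = ρ P' → ∀ x : ℤ × ℤ, x ∉ S → ext P x.1 x.2 = ext P' x.1 x.2 := by
    intro P P' h x hx
    by_cases hxn : x ∈ sq n
    · rw [mem_sq] at hxn
      obtain ⟨h1, h2, h3, h4⟩ := hxn
      have := congrFun h ⟨(⟨x.1.toNat, by omega⟩, ⟨x.2.toNat, by omega⟩), by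
        simp only [c]
        rwa [Int.toNat_of_nonneg h1, Int.toNat_of_nonneg h3]⟩
      simp only [ρ] at this
      unfold ext
      rw [dif_pos ⟨⟨h1, h2⟩, h3, h4⟩, dif_pos ⟨⟨h1, h2⟩, h3, h4⟩]
      exact this
    · rw [ext_out _ _ hxn, ext_out _ _ hxn]
  have h1 : B.card ≤ N * (B.image ρ).card := by
    refine Finset.card_le_mul_card_image B N ?_
    intro b hb
    obtain ⟨P0, hP0, rfl⟩ := Finset.mem_image.1 hb
    have hE0 : E (ext P0) := (Finset.mem_filter.1 hP0).2
    refine le_trans ?_ (hN _ hE0)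
    have hch : ∀ P : Fin n × Fin n → Bool, ∃ w : ω, E (ext P) → w ∈ W (ext P) ∧ R (ext P) w := by
      intro P
      by_cases hP : E (ext P)
      · obtain ⟨w, h⟩ := hE _ hP
        exact ⟨w, fun _ => h⟩
      · obtain ⟨w, h⟩ := hE _ hE0
        exact ⟨w, fun h => absurd h hP⟩
    choose g hg using hch
    refine Finset.card_le_card_of_injOn g ?_ ?_
    · intro P hP
      simp only [hB, Finset.coe_filter, Finset.mem_filter, Finset.mem_univ, true_and,
        Set.mem_ofPred_eq] at hP
      have := (hg P hP.1).1
      rw [hW _ (ext P0) (hoff _ _ hP.2)] at this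
      exact this
    · intro P hP P' hP' hgg
      simp only [hB, Finset.coe_filter, Finset.mem_filter, Finset.mem_univ, true_and,
        Set.mem_ofPred_eq] at hP hP'
      have ho := hoff P P' (hP.2.trans hP'.2.symm)
      have := hR (ext P) (ext P') (g P) (hg P hP.1).1 (hg P hP.1).2
        (by rw [hgg]; exact (hg P' hP'.1).2) ho
      refine ext_inj fun i j _ _ _ _ => ?_
      by_cases hx : (i, j) ∈ S
      · exact this _ hx
      · exact ho (i, j) hx
  have h2 : (B.image ρ).card ≤ 2 ^ (n ^ 2 - S.card) := by
    refine (Finset.card_le_univ _).trans ?_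
    rw [Fintype.card_fun, Fintype.card_bool]
    refine Nat.pow_le_pow_right (by norm_num) ?_
    rw [Fintype.card_subtype_compl, Fintype.card_prod, Fintype.card_fin]
    have : Fintype.card {x // c x ∈ S} = S.card := by
      rw [Fintype.card_subtype, ← Finset.card_map ⟨c, hcinj⟩]
      congr 1
      ext x
      simp only [Finset.mem_map, Finset.mem_filter, Finset.mem_univ, true_and,
        Function.Embedding.coeFn_mk]
      constructor
      · rintro ⟨y, hy, rfl⟩; exact hy
      · intro hx
        obtain ⟨h1, h2, h3, h4⟩ := mem_sq.1 (hS hx)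
        have : c (⟨x.1.toNat, by omega⟩, ⟨x.2.toNat, by omega⟩) = x := by
          simp only [c]
          rw [Int.toNat_of_nonneg h1, Int.toNat_of_nonneg h3]
        exact ⟨_, by rw [this]; exact hx, this⟩
    rw [this, ← pow_two]
  have hSc : S.card ≤ n ^ 2 := by rw [← card_sq]; exact Finset.card_le_card hS
  have h3 : B.card * 2 ^ S.card ≤ N * 2 ^ (n ^ 2) := by
    calc B.card * 2 ^ S.card ≤ (N * 2 ^ (n ^ 2 - S.card)) * 2 ^ S.card := by
          gcongr; exact h1.trans (by gcongr)
      _ = N * 2 ^ (n ^ 2) := by rw [mul_assoc, ← pow_add, Nat.sub_add_cancel hSc]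
  unfold pr
  rw [div_le_div_iff₀ (by positivity) (by positivity)]
  exact_mod_cast h3

end RP

namespace RP

lemma pr_and {n : ℕ} (c : Prop) {E : Pic → Prop} {b : ℝ} (hb : 0 ≤ b) (h : c → pr n E ≤ b) :
    pr n (fun p => c ∧ E p) ≤ b := by
  by_cases hc : c
  · exact (pr_mono (fun p hp => hp.2)).trans (h hc)
  · have := pr_union (n := n) (∅ : Finset ℕ) (fun _ _ => True) 0 (G := fun p => c ∧ E p)
      (fun p hp => absurd hp.1 hc) (by simp)
    simp at this
    exact this.trans hb

/-- boxes -/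
noncomputable def bx (w h : ℕ) (z : ℤ × ℤ) : Finset (ℤ × ℤ) :=
  Finset.Ico z.1 (z.1 + w) ×ˢ Finset.Ico z.2 (z.2 + h)

lemma card_bx (w h : ℕ) (z : ℤ × ℤ) : (bx w h z).card = w * h := by
  simp [bx, Finset.card_product]

lemma mem_bx {w h : ℕ} {z x : ℤ × ℤ} :
    x ∈ bx w h z ↔ z.1 ≤ x.1 ∧ x.1 < z.1 + w ∧ z.2 ≤ x.2 ∧ x.2 < z.2 + h := by
  simp [bx]; tauto

lemma bx_sub {n w h : ℕ} {z : ℤ × ℤ} (hv : Val n w h z.1 z.2) : bx w h z ⊆ sq n := by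
  intro x hx
  rw [mem_bx] at hx
  rw [mem_sq]
  unfold Val at hv
  omega

lemma val_sq {n w h : ℕ} {z : ℤ × ℤ} (hw : 1 ≤ w) (hh : 1 ≤ h) (hv : Val n w h z.1 z.2) :
    z ∈ sq n := by
  rw [mem_sq]; unfold Val at hv; omega

lemma bx_disj {w h w' h' : ℕ} {z v : ℤ × ℤ} (hd : z.1 + w ≤ v.1 ∨ v.1 + w' ≤ z.1 ∨
    z.2 + h ≤ v.2 ∨ v.2 + h' ≤ z.2) : Disjoint (bx w h z) (bx w' h' v) := by
  rw [Finset.disjoint_left]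
  intro x hx hx'
  rw [mem_bx] at hx hx'
  omega

lemma near_one {n w h : ℕ} {z v : ℤ × ℤ} (hv : Val n w h v.1 v.2) (hne : v.1 ≠ z.1 ∨ v.2 ≠ z.2) :
    pr n (fun p => Beq w h p p z.1 z.2 v.1 v.2) ≤ 1 / 2 ^ (w * h) := by
  have := key n (bx w h v) (bx_sub hv) (ω := Unit) (fun _ => {()}) 1
    (fun p => Beq w h p p z.1 z.2 v.1 v.2) (fun p _ => Beq w h p p z.1 z.2 v.1 v.2)
    (by simp) (by simp) (by simp) ?_
  · rw [card_bx] at this; exact_mod_cast this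
  · intro p p' _ _ h1 h2 hoff
    obtain ⟨μ, hμ0, hμ⟩ : ∃ μ : ℤ × ℤ → ℤ, (∀ x ∈ bx w h v, 0 ≤ μ x) ∧
        ∀ x : ℤ × ℤ, μ (x.1 - v.1 + z.1, x.2 - v.2 + z.2) < μ x := by
      have : z.1 < v.1 ∨ v.1 < z.1 ∨ z.2 < v.2 ∨ v.2 < z.2 := by omega
      rcases this with hlt | hlt | hlt | hlt
      · refine ⟨fun x => x.1 - v.1, fun x hx => ?_, fun x => ?_⟩
        · rw [mem_bx] at hx; beta_reduce; omega
        · beta_reduce; simp only; omega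
      · refine ⟨fun x => v.1 + w - x.1, fun x hx => ?_, fun x => ?_⟩
        · rw [mem_bx] at hx; beta_reduce; omega
        · beta_reduce; simp only; omega
      · refine ⟨fun x => x.2 - v.2, fun x hx => ?_, fun x => ?_⟩
        · rw [mem_bx] at hx; beta_reduce; omega
        · beta_reduce; simp only; omega
      · refine ⟨fun x => v.2 + h - x.2, fun x hx => ?_, fun x => ?_⟩
        · rw [mem_bx] at hx; beta_reduce; omega
        · beta_reduce; simp only; omega
    have hind : ∀ N : ℕ, ∀ x ∈ bx w h v, μ x < N → p x.1 x.2 = p' x.1 x.2 := by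
      intro N
      induction N with
      | zero => intro x hx hlt; have := hμ0 x hx; push_cast at hlt; omega
      | succ N ih =>
        intro x hx hlt
        have hx' := mem_bx.1 hx
        have e1 := h1 (x.1 - v.1) (x.2 - v.2) (by omega) (by omega) (by omega) (by omega)
        have e2 := h2 (x.1 - v.1) (x.2 - v.2) (by omega) (by omega) (by omega) (by omega)
        rw [show v.1 + (x.1 - v.1) = x.1 by ring, show v.2 + (x.2 - v.2) = x.2 by ring,
          show z.1 + (x.1 - v.1) = x.1 - v.1 + z.1 by ring,
          show z.2 + (x.2 - v.2) = x.2 - v.2 + z.2 by ring] at e1 e2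
        rw [← e1, ← e2]
        by_cases hy : (x.1 - v.1 + z.1, x.2 - v.2 + z.2) ∈ bx w h v
        · exact ih (x.1 - v.1 + z.1, x.2 - v.2 + z.2) hy (by have := hμ x; push_cast at hlt; omega)
        · exact hoff _ hy
    intro x hx
    exact hind ((μ x).toNat + 1) x hx (by have := hμ0 x hx; push_cast; omega)

lemma pr_near {n m D : ℕ} (hm : 1 ≤ m) :
    pr n (fun p => ¬ NoNear n (m+1:ℕ) D p) ≤
      (2 * D + 1) ^ 2 * ((n:ℝ) ^ 2 / 2 ^ (m * (m+1))) := by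
  have := pr_union (n := n) (sq n ×ˢ (Finset.Icc (-(D:ℤ)) D ×ˢ Finset.Icc (-(D:ℤ)) D))
    (fun i p => (Val n m (m+1:ℕ) (i.1.1 + i.2.1) (i.1.2 + i.2.2) ∧ (i.2.1 ≠ 0 ∨ i.2.2 ≠ 0)) ∧
      Beq m (m+1:ℕ) p p i.1.1 i.1.2 (i.1.1 + i.2.1) (i.1.2 + i.2.2))
    (1 / 2 ^ (m * (m+1))) (G := fun p => ¬ NoNear n (m+1:ℕ) D p) ?_ ?_
  · refine this.trans (le_of_eq ?_)
    rw [Finset.card_product, Finset.card_product, card_sq, Int.card_Icc,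
      show ((D:ℤ) + 1 - -(D:ℤ)).toNat = 2 * D + 1 by omega]
    push_cast
    ring
  · intro p hp
    unfold NoNear at hp
    push Not at hp
    obtain ⟨z1, z2, w1, w2, hz, hw, hne, hb, hf⟩ := hp
    rw [show ((m+1:ℕ):ℤ) - 1 = m by push_cast; ring] at *
    refine ⟨((z1, z2), (w1 - z1, w2 - z2)), ?_, ⟨?_, ?_⟩, ?_⟩
    · rw [Finset.mem_product, Finset.mem_product, Finset.mem_Icc, Finset.mem_Icc]
      refine ⟨val_sq (w := m) (h := m+1) hm (by omega) hz, ?_, ?_⟩ <;>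
      · unfold Far at hf; simp only; omega
    · simpa using hw
    · simp only; omega
    · simpa using hb
  · intro i _
    refine pr_and _ (by positivity) fun hc => ?_
    exact near_one (z := i.1) (v := (i.1.1 + i.2.1, i.1.2 + i.2.2)) hc.1
      (by have := hc.2; simp only; omega)

/-- disjoint boxes all having far repetitions -/
lemma far_reps {n w h l : ℕ} {D : ℤ} (hw : 1 ≤ w) (hh : 1 ≤ h) (z : Fin l → ℤ × ℤ)
    (hz : ∀ i, Val n w h (z i).1 (z i).2)
    (hd : ∀ i j, i ≠ j → Disjoint (bx w h (z i)) (bx w h (z j)))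
    (hf : ∀ i j (v : ℤ × ℤ), Far D (z i).1 (z i).2 v.1 v.2 → Disjoint (bx w h v) (bx w h (z j))) :
    pr n (fun p => ∀ i, ∃ v : ℤ × ℤ, Val n w h v.1 v.2 ∧ Far D (z i).1 (z i).2 v.1 v.2 ∧
      Beq w h p p (z i).1 (z i).2 v.1 v.2) ≤ ((n:ℝ) ^ 2 / 2 ^ (w * h)) ^ l := by
  classical
  have := key n (Finset.univ.biUnion fun i => bx w h (z i)) ?_ (ω := Fin l → ℤ × ℤ)
    (fun _ => Fintype.piFinset fun _ => sq n) ((n ^ 2) ^ l)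
    (fun p => ∀ i, ∃ v : ℤ × ℤ, Val n w h v.1 v.2 ∧ Far D (z i).1 (z i).2 v.1 v.2 ∧
      Beq w h p p (z i).1 (z i).2 v.1 v.2)
    (fun p v => ∀ i, Far D (z i).1 (z i).2 (v i).1 (v i).2 ∧
      Beq w h p p (z i).1 (z i).2 (v i).1 (v i).2) ?_ ?_ ?_ ?_
  · refine this.trans (le_of_eq ?_)
    rw [Finset.card_biUnion (fun i _ j _ hij => hd i j hij)]
    simp only [card_bx, Finset.sum_const, Finset.card_univ, Fintype.card_fin, smul_eq_mul]
    rw [div_pow, mul_comm l, pow_mul (2:ℝ)]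
    push_cast
    rfl
  · intro x hx
    obtain ⟨i, -, hi⟩ := Finset.mem_biUnion.1 hx
    exact bx_sub (hz i) hi
  · intro p _
    rw [Fintype.card_piFinset]
    simp [card_sq]
  · intros; rfl
  · intro p hp
    choose v h1 h2 h3 using hp
    refine ⟨v, ?_, fun i => ⟨h2 i, h3 i⟩⟩
    rw [Fintype.mem_piFinset]
    exact fun i => val_sq hw hh (h1 i)
  · intro p p' v _ h1 h2 hoff x hx
    obtain ⟨i, -, hi⟩ := Finset.mem_biUnion.1 hx
    have hx' := mem_bx.1 hi
    have e1 := (h1 i).2 (x.1 - (z i).1) (x.2 - (z i).2) (by omega) (by omega) (by omega) (by omega)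
    have e2 := (h2 i).2 (x.1 - (z i).1) (x.2 - (z i).2) (by omega) (by omega) (by omega) (by omega)
    rw [show (z i).1 + (x.1 - (z i).1) = x.1 by ring,
      show (z i).2 + (x.2 - (z i).2) = x.2 by ring] at e1 e2
    rw [e1, e2]
    refine hoff ((v i).1 + (x.1 - (z i).1), (v i).2 + (x.2 - (z i).2)) ?_
    intro hmem
    obtain ⟨j, -, hj⟩ := Finset.mem_biUnion.1 hmem
    refine (Finset.disjoint_left.1 (hf i j (v i) (h1 i).1)) ?_ hj
    rw [mem_bx]; simp only; omega

lemma pr_norep {n m : ℕ} {D : ℕ} (hm : 1 ≤ m) (hD : m + 1 ≤ D) (s : ℕ) (u1 u2 : ℤ) :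
    pr n (fun p => NoNear n (m+1:ℕ) D p ∧ ¬ NoRepW n (m+1:ℕ) s p u1 u2) ≤
      (s + 1) ^ 2 * ((n:ℝ) ^ 2 / 2 ^ (m * (m+1))) := by
  have := pr_union (n := n) (Finset.Icc u1 (u1 + s) ×ˢ Finset.Icc u2 (u2 + s))
    (fun z p => Val n m (m+1:ℕ) z.1 z.2 ∧ ∀ i : Fin 1, ∃ v : ℤ × ℤ, Val n m (m+1:ℕ) v.1 v.2 ∧
      Far D z.1 z.2 v.1 v.2 ∧ Beq m (m+1:ℕ) p p z.1 z.2 v.1 v.2)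
    ((n:ℝ) ^ 2 / 2 ^ (m * (m+1)))
    (G := fun p => NoNear n (m+1:ℕ) D p ∧ ¬ NoRepW n (m+1:ℕ) s p u1 u2) ?_ ?_
  · refine this.trans (le_of_eq ?_)
    rw [Finset.card_product, Int.card_Icc, Int.card_Icc,
      show (u1 + s + 1 - u1).toNat = s + 1 by omega, show (u2 + s + 1 - u2).toNat = s + 1 by omega]
    push_cast
    ring
  · rintro p ⟨hnn, hp⟩
    unfold NoRepW at hp
    push Not at hp
    obtain ⟨z1, z2, a1, a2, a3, a4, hv, w1, w2, hw, hb, hne⟩ := hp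
    have hfar := hnn z1 z2 w1 w2 hv hw hne hb
    rw [show ((m+1:ℕ):ℤ) - 1 = m by push_cast; ring] at *
    refine ⟨(z1, z2), ?_, hv, fun _ => ⟨(w1, w2), hw, hfar, hb⟩⟩
    rw [Finset.mem_product, Finset.mem_Icc, Finset.mem_Icc]
    exact ⟨⟨a1, a2⟩, a3, a4⟩
  · intro z _
    refine pr_and _ (by positivity) fun hc => ?_
    have := far_reps (n := n) (D := D) (w := m) (h := m+1) hm (by omega) (fun _ : Fin 1 => z)
      (fun _ => hc) (fun i j hij => absurd (Subsingleton.elim i j) hij)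
      (fun i j v hv => bx_disj (by unfold Far at hv; omega))
    simpa using this

end RP

namespace RP

lemma pr_e1 {n m K l : ℕ} {D : ℕ} (hm : 1 ≤ m) (hD : K + 2 + l * (m+1) + (m + 1) ≤ D) :
    pr n (fun p => NoNear n (m+1:ℕ) D p ∧ ¬ E1 n (m+1:ℕ) K (l * (m+1) : ℕ) p) ≤
      (n + 1) ^ 2 * ((K + 3) * ((n:ℝ) ^ 2 / 2 ^ (m * (m+1)))) ^ l := by
  classical
  let z : (ℤ × ℤ) × (Fin l → ℤ) → Fin l → ℤ × ℤ := fun u i =>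
    (u.1.1 + u.2 i, u.1.2 + ((i:ℕ) * (m+1) : ℕ))
  have hrow : ∀ i j : Fin l, i < j → (i:ℕ) * (m+1) + (m+1) ≤ (j:ℕ) * (m+1) := by
    intro i j hij
    have : (i:ℕ) + 1 ≤ j := hij
    nlinarith
  have hrow' : ∀ i : Fin l, (i:ℕ) * (m+1) + (m+1) ≤ l * (m+1) := by
    intro i
    have : (i:ℕ) + 1 ≤ l := i.2
    nlinarith
  have := pr_union (n := n) ((Finset.Icc (0:ℤ) n ×ˢ Finset.Icc (0:ℤ) n) ×ˢ
      (Fintype.piFinset fun _ : Fin l => Finset.Icc (0:ℤ) (K+2)))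
    (fun u p => (∀ i, Val n m (m+1:ℕ) (z u i).1 (z u i).2) ∧
      ∀ i, ∃ v : ℤ × ℤ, Val n m (m+1:ℕ) v.1 v.2 ∧
      Far D (z u i).1 (z u i).2 v.1 v.2 ∧ Beq m (m+1:ℕ) p p (z u i).1 (z u i).2 v.1 v.2)
    (((n:ℝ) ^ 2 / 2 ^ (m * (m+1))) ^ l)
    (G := fun p => NoNear n (m+1:ℕ) D p ∧ ¬ E1 n (m+1:ℕ) K (l * (m+1) : ℕ) p) ?_ ?_
  · refine this.trans (le_of_eq ?_)
    rw [Finset.card_product, Finset.card_product, Int.card_Icc, Fintype.card_piFinset,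
      Int.card_Icc, show ((n:ℤ) + 1 - 0).toNat = n + 1 by omega,
      show ((K:ℤ) + 2 + 1 - 0).toNat = K + 3 by omega, Finset.prod_const, Finset.card_univ,
      Fintype.card_fin, mul_pow]
    push_cast
    ring
  · rintro p ⟨hnn, hp⟩
    unfold E1 at hp
    push Not at hp
    obtain ⟨u1, u2, a1, a2, a3, a4, hb⟩ := hp
    have hx : ∀ i : Fin l, ∃ x : ℤ, (0 ≤ x ∧ x ≤ K + 2) ∧ Val n m (m+1:ℕ) (u1 + x)
        (u2 + ((i:ℕ) * (m+1) : ℕ)) ∧ ∃ v : ℤ × ℤ, Val n m (m+1:ℕ) v.1 v.2 ∧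
        Far D (u1 + x) (u2 + ((i:ℕ) * (m+1) : ℕ)) v.1 v.2 ∧
        Beq m (m+1:ℕ) p p (u1 + x) (u2 + ((i:ℕ) * (m+1) : ℕ)) v.1 v.2 := by
      intro i
      have := hb (u2 + ((i:ℕ) * (m+1) : ℕ)) (by omega) (by have := hrow' i; omega)
      unfold RowFree at this
      push Not at this
      obtain ⟨z1, b1, b2, hv, w1, w2, hw, hbe, hne⟩ := this
      have hfar := hnn _ _ w1 w2 hv hw hne hbe
      rw [show ((m+1:ℕ):ℤ) - 1 = m by push_cast; ring] at *
      refine ⟨z1 - u1, by omega, ?_, (w1, w2), hw, ?_, ?_⟩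
      · rwa [add_sub_cancel]
      · rwa [add_sub_cancel]
      · rwa [add_sub_cancel]
    choose x hx1 hx2 hx3 using hx
    refine ⟨((u1, u2), x), ?_, hx2, hx3⟩
    rw [Finset.mem_product, Finset.mem_product, Finset.mem_Icc, Finset.mem_Icc,
      Fintype.mem_piFinset]
    refine ⟨⟨⟨a1, a2⟩, a3, ?_⟩, fun i => Finset.mem_Icc.2 (hx1 i)⟩
    show u2 ≤ n
    push_cast at a4
    have : 0 ≤ (l:ℤ) * (m+1) := by positivity
    omega
  · intro u hu
    refine pr_and _ (by positivity) fun hc => ?_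
    rw [Finset.mem_product, Fintype.mem_piFinset] at hu
    have hu2 := fun i => Finset.mem_Icc.1 (hu.2 i)
    refine far_reps (n := n) (D := D) (w := m) (h := m+1) hm (by omega) (z u) hc ?_ ?_
    · intro i j hij
      apply bx_disj
      rcases lt_or_gt_of_ne hij with hlt | hlt
      · have := hrow i j hlt
        simp only [z]; omega
      · have := hrow j i hlt
        simp only [z]; omega
    · intro i j v hv
      apply bx_disj
      have := hrow' i
      have := hrow' j
      have := hu2 i
      have := hu2 j
      simp only [z] at *
      unfold Far at hv
      omega

/-- every `k × (k-1)` pattern occurs at most `M` times -/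
def Mult (n k : ℤ) (N M : ℕ) (p : Pic) : Prop :=
  ∀ z1 z2, ∀ T : Finset (ℤ × ℤ), (∀ v ∈ T, Val n k (k-1) v.1 v.2 ∧
    Beq k (k-1) p p z1 z2 v.1 v.2) → T ⊆ sq N → T.card ≤ M

lemma pr_mult {n m M : ℕ} {D : ℕ} (hD : m + 1 ≤ D) :
    pr n (fun p => NoNear n (m+1:ℕ) D (tr p) ∧ ¬ Mult n (m+1:ℕ) n M p) ≤
      (n:ℝ) ^ 2 * ((n:ℝ) ^ 2 / 2 ^ (m * (m+1))) ^ M := by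
  classical
  have := pr_union (n := n) (Fintype.piFinset fun _ : Fin (M+1) => sq n)
    (fun f p => ((∀ i, Val n (m+1:ℕ) m (f i).1 (f i).2) ∧
      (∀ i j, i ≠ j → Far D (f i).1 (f i).2 (f j).1 (f j).2)) ∧
      ∀ i, Beq (m+1:ℕ) m p p (f 0).1 (f 0).2 (f i).1 (f i).2)
    (1 / (2 ^ (m * (m+1))) ^ M)
    (G := fun p => NoNear n (m+1:ℕ) D (tr p) ∧ ¬ Mult n (m+1:ℕ) n M p) ?_ ?_
  · refine this.trans (le_of_eq ?_)
    rw [Fintype.card_piFinset, Finset.prod_const, Finset.card_univ, Fintype.card_fin, card_sq,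
      div_pow, pow_succ]
    push_cast
    ring
  · rintro p ⟨hnn, hp⟩
    unfold Mult at hp
    push Not at hp
    obtain ⟨z1, z2, T, hT, hTs, hc⟩ := hp
    obtain ⟨T', hT', hc'⟩ := Finset.exists_subset_card_eq (show M + 1 ≤ T.card from hc)
    let e := (T'.equivFinOfCardEq hc').symm
    have he : ∀ i, (e i : ℤ × ℤ) ∈ T := fun i => hT' (e i).2
    have hbq : ∀ i j, Beq (m+1:ℕ) m p p (e i : ℤ × ℤ).1 (e i : ℤ × ℤ).2 (e j : ℤ × ℤ).1
        (e j : ℤ × ℤ).2 := by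
      intro i j a b x1 x2 x3 x4
      have h1 := (hT _ (he i)).2 a b x1 x2 x3 (by push_cast; omega)
      have h2 := (hT _ (he j)).2 a b x1 x2 x3 (by push_cast; omega)
      rw [← h1, ← h2]
    rw [show ((m+1:ℕ):ℤ) - 1 = m by push_cast; ring] at *
    refine ⟨fun i => (e i : ℤ × ℤ), ?_, ⟨?_, ?_⟩, ?_⟩
    · rw [Fintype.mem_piFinset]; exact fun i => hTs (he i)
    · exact fun i => (hT _ (he i)).1
    · intro i j hij
      have hne : (e i : ℤ × ℤ) ≠ (e j : ℤ × ℤ) := by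
        intro h; exact hij (e.injective (Subtype.ext h))
      have hne' : (e j : ℤ × ℤ).2 ≠ (e i : ℤ × ℤ).2 ∨ (e j : ℤ × ℤ).1 ≠ (e i : ℤ × ℤ).1 := by
        by_contra hcon
        push Not at hcon
        exact hne (Prod.ext hcon.2.symm hcon.1.symm)
      have := hnn (e i : ℤ × ℤ).2 (e i : ℤ × ℤ).1 (e j : ℤ × ℤ).2 (e j : ℤ × ℤ).1
        (by rw [show ((m+1:ℕ):ℤ) - 1 = m by push_cast; ring]; exact Val_tr (hT _ (he i)).1)
        (by rw [show ((m+1:ℕ):ℤ) - 1 = m by push_cast; ring]; exact Val_tr (hT _ (he j)).1)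
        hne' (by
          rw [show ((m+1:ℕ):ℤ) - 1 = m by push_cast; ring]
          exact Beq_tr (hbq i j))
      unfold Far at *
      beta_reduce
      omega
    · exact fun i => hbq 0 i
  · intro f hf
    refine pr_and _ (by positivity) fun hc => ?_
    have hd : ∀ i j, i ≠ j → Disjoint (bx (m+1) m (f i)) (bx (m+1) m (f j)) := by
      intro i j hij
      apply bx_disj
      have := hc.2 i j hij
      unfold Far at this
      omega
    have := key n (Finset.univ.biUnion fun i : Fin M => bx (m+1) m (f i.succ)) ?_ (ω := Unit)
      (fun _ => {()}) 1
      (fun p => ∀ i, Beq (m+1:ℕ) m p p (f 0).1 (f 0).2 (f i).1 (f i).2)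
      (fun p _ => ∀ i, Beq (m+1:ℕ) m p p (f 0).1 (f 0).2 (f i).1 (f i).2)
      (by simp) (by simp) (by simp) ?_
    · refine this.trans (le_of_eq ?_)
      rw [Finset.card_biUnion (fun i _ j _ hij => hd _ _ (fun h => hij (Fin.succ_injective _ h)))]
      simp only [card_bx, Finset.sum_const, Finset.card_univ, Fintype.card_fin, smul_eq_mul]
      rw [← pow_mul, mul_comm M, mul_comm (m+1)]
      push_cast
      rfl
    · intro x hx
      obtain ⟨i, -, hi⟩ := Finset.mem_biUnion.1 hx
      exact bx_sub (hc.1 _) hi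
    · intro p p' _ _ h1 h2 hoff x hx
      obtain ⟨i, -, hi⟩ := Finset.mem_biUnion.1 hx
      have hx' := mem_bx.1 hi
      set y := f i.succ
      have e1 := (h1 i.succ) (x.1 - y.1) (x.2 - y.2) (by omega) (by omega) (by omega) (by omega)
      have e2 := (h2 i.succ) (x.1 - y.1) (x.2 - y.2) (by omega) (by omega) (by omega) (by omega)
      rw [show (f i.succ).1 + (x.1 - y.1) = x.1 by simp only [y]; ring,
        show (f i.succ).2 + (x.2 - y.2) = x.2 by simp only [y]; ring] at e1 e2
      rw [← e1, ← e2]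
      refine hoff ((f 0).1 + (x.1 - y.1), (f 0).2 + (x.2 - y.2)) ?_
      intro hmem
      obtain ⟨j, -, hj⟩ := Finset.mem_biUnion.1 hmem
      refine (Finset.disjoint_left.1 (hd 0 j.succ (Fin.succ_ne_zero j).symm)) ?_ hj
      rw [mem_bx]; simp only; omega

/-- counting walks -/
lemma walk_card {α : Type*} [DecidableEq α] (V : Finset α) (adj : α → α → Prop) (M : ℕ)
    [DecidableRel adj]
    (hM : ∀ v ∈ V, (V.filter (adj v)).card ≤ M) (m : ℕ) :
    ((Fintype.piFinset fun _ : Fin (m+1) => V).filter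
      (fun f => ∀ a : Fin m, adj (f a.castSucc) (f a.succ))).card ≤ V.card * M ^ m := by
  induction m with
  | zero =>
    refine (Finset.card_filter_le _ _).trans ?_
    rw [Fintype.card_piFinset]; simp
  | succ m ih =>
    set A := (Fintype.piFinset fun _ : Fin (m+1+1) => V).filter
      (fun f => ∀ a : Fin (m+1), adj (f a.castSucc) (f a.succ)) with hA
    let g : (Fin (m+1+1) → α) → (Fin (m+1) → α) := fun f => Fin.init f
    have h1 : A.card ≤ M * (A.image g).card := by
      refine Finset.card_le_mul_card_image A M ?_
      intro b hb
      obtain ⟨f0, hf0, rfl⟩ := Finset.mem_image.1 hb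
      rw [hA, Finset.mem_filter, Fintype.mem_piFinset] at hf0
      refine le_trans ?_ (hM (f0 (Fin.last m).castSucc) (hf0.1 _))
      refine Finset.card_le_card_of_injOn (fun f => f (Fin.last (m+1))) ?_ ?_
      · intro f hf
        simp only [hA, Finset.coe_filter, Finset.mem_filter, Fintype.mem_piFinset,
          Set.mem_ofPred_eq] at hf
        obtain ⟨⟨h1, h2⟩, h3⟩ := hf
        simp only [Finset.coe_filter, Set.mem_ofPred_eq]
        refine ⟨h1 _, ?_⟩
        have := h2 (Fin.last m)
        rw [show f0 (Fin.last m).castSucc = f (Fin.last m).castSucc from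
          (congrFun h3 (Fin.last m)).symm]
        exact this
      · intro f hf f' hf' heq
        simp only [hA, Finset.coe_filter, Finset.mem_filter, Fintype.mem_piFinset,
          Set.mem_ofPred_eq] at hf hf'
        have : g f = g f' := hf.2.trans hf'.2.symm
        funext i
        exact Fin.lastCases (motive := fun i => f i = f' i) heq (fun j => congrFun this j) i
    have h2 : (A.image g).card ≤ V.card * M ^ m := by
      refine le_trans (Finset.card_le_card ?_) ih
      intro b hb
      obtain ⟨f, hf, rfl⟩ := Finset.mem_image.1 hb
      rw [hA, Finset.mem_filter, Fintype.mem_piFinset] at hf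
      rw [Finset.mem_filter, Fintype.mem_piFinset]
      exact ⟨fun a => hf.1 _, fun a => hf.2 a.castSucc⟩
    calc A.card ≤ M * (V.card * M ^ m) := h1.trans (by gcongr)
      _ = V.card * M ^ (m+1) := by ring

end RP

namespace RP

open scoped Classical in
noncomputable def Vs (n m : ℕ) (S : Finset (ℤ × ℤ)) : Finset (ℤ × ℤ) :=
  (sq n).filter fun v => Val n (m+1:ℕ) (m+1:ℕ) v.1 v.2 ∧ Disjoint (bx (m+1) (m+1) v) S

def Adj (m : ℕ) (p : Pic) (v v' : ℤ × ℤ) : Prop := Beq (m+1:ℕ) m p p v.1 (v.2+1) v'.1 v'.2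

open scoped Classical in
/-- walks avoiding `S` -/
noncomputable def Wk (n m : ℕ) (S : Finset (ℤ × ℤ)) (p : Pic) : Finset (Fin (m+1) → ℤ × ℤ) :=
  (Fintype.piFinset fun _ : Fin (m+1) => Vs n m S).filter
    (fun f => ∀ a : Fin m, Adj m p (f a.castSucc) (f a.succ))

lemma Wk_card {n m M : ℕ} {S : Finset (ℤ × ℤ)} {p : Pic} (hM : Mult n (m+1:ℕ) n M p) :
    (Wk n m S p).card ≤ n ^ 2 * M ^ m := by
  classical
  have hV : (Vs n m S).card ≤ n ^ 2 := by
    rw [← card_sq]; exact Finset.card_le_card (Finset.filter_subset _ _)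
  have := walk_card (Vs n m S) (Adj m p) M ?_ m
  · refine le_trans ?_ (this.trans (by gcongr))
    unfold Wk
    refine le_of_eq ?_
    congr!
  · intro v _
    refine hM v.1 (v.2+1) _ ?_ ?_
    · intro v' hv'
      rw [Finset.mem_filter] at hv'
      obtain ⟨h1, h2⟩ := hv'
      unfold Vs at h1
      rw [Finset.mem_filter] at h1
      rw [show ((m+1:ℕ):ℤ) - 1 = m by push_cast; ring]
      refine ⟨?_, h2⟩
      have := h1.2.1
      unfold Val at *
      push_cast at *
      omega
    · exact (Finset.filter_subset _ _).trans (Finset.filter_subset _ _)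

lemma Wk_mem {n m : ℕ} {S : Finset (ℤ × ℤ)} {p : Pic} {f : Fin (m+1) → ℤ × ℤ} :
    f ∈ Wk n m S p ↔ (∀ a, f a ∈ sq n ∧ Val n (m+1:ℕ) (m+1:ℕ) (f a).1 (f a).2 ∧
      Disjoint (bx (m+1) (m+1) (f a)) S) ∧ ∀ a : Fin m, Adj m p (f a.castSucc) (f a.succ) := by
  classical
  unfold Wk
  rw [Finset.mem_filter, Fintype.mem_piFinset]
  simp only [Vs, Finset.mem_filter]

lemma Wk_off {n m : ℕ} {S : Finset (ℤ × ℤ)} {p p' : Pic} {f : Fin (m+1) → ℤ × ℤ}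
    (hf : f ∈ Wk n m S p) (hoff : ∀ x : ℤ × ℤ, x ∉ S → p x.1 x.2 = p' x.1 x.2)
    (a : Fin (m+1)) (i j : ℤ) (h1 : 0 ≤ i) (h2 : i < m+1) (h3 : 0 ≤ j) (h4 : j < m+1) :
    p ((f a).1 + i) ((f a).2 + j) = p' ((f a).1 + i) ((f a).2 + j) := by
  refine hoff ((f a).1 + i, (f a).2 + j) ?_
  refine Finset.disjoint_left.1 ((Wk_mem.1 hf).1 a).2.2 ?_
  rw [mem_bx]; push_cast; omega

lemma Wk_sub {n m : ℕ} {S : Finset (ℤ × ℤ)} {p p' : Pic}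
    (hoff : ∀ x : ℤ × ℤ, x ∉ S → p x.1 x.2 = p' x.1 x.2) : Wk n m S p ⊆ Wk n m S p' := by
  intro f hf
  rw [Wk_mem]
  refine ⟨(Wk_mem.1 hf).1, fun a i j h1 h2 h3 h4 => ?_⟩
  push_cast at h2
  have := (Wk_mem.1 hf).2 a i j h1 (by push_cast; exact h2) h3 h4
  rw [add_assoc] at this ⊢
  rw [← Wk_off hf hoff _ _ _ h1 h2 (by omega) (by omega),
    ← Wk_off hf hoff _ _ _ h1 h2 (by omega) (by omega)]
  exact this

lemma Wk_congr {n m : ℕ} {S : Finset (ℤ × ℤ)} {p p' : Pic}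
    (hoff : ∀ x : ℤ × ℤ, x ∉ S → p x.1 x.2 = p' x.1 x.2) : Wk n m S p = Wk n m S p' :=
  Finset.Subset.antisymm (Wk_sub hoff) (Wk_sub fun x hx => (hoff x hx).symm)

def Str (m : ℕ) (δ c r : ℤ) (p : Pic) (f : Fin (m+1) → ℤ × ℤ) : Prop :=
  ∀ a : Fin (m+1), ∀ i j : ℤ, δ ≤ i → i < δ + m → 0 ≤ j → j < m + 1 →
    p (c + i) (r + (a:ℕ) + j) = p ((f a).1 + i) ((f a).2 + j)

lemma E2_walk {n m : ℕ} {D : ℤ} {p : Pic} {i0 c r δ : ℤ} {S : Finset (ℤ × ℤ)}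
    (h : E2 n (m+1:ℕ) D p i0 c r)
    (hδ : (i0 = 0 ∧ δ = 1) ∨ (i0 = m ∧ δ = 0))
    (hfar : ∀ a : ℤ, 0 ≤ a → a ≤ m → ∀ v : ℤ × ℤ, Far D c (r+a) v.1 v.2 →
      Disjoint (bx (m+1) (m+1) v) S) : ∃ f ∈ Wk n m S p, Str m δ c r p f := by
  obtain ⟨-, -, -, -, w1, w2, hw⟩ := h
  refine ⟨fun a => (w1 (a:ℕ), w2 (a:ℕ)), ?_, ?_⟩
  · rw [Wk_mem]
    constructor
    · intro a
      obtain ⟨h1, h2, -⟩ := hw (a:ℕ) (by omega) (by push_cast; omega)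
      exact ⟨val_sq (z := (w1 (a:ℕ), w2 (a:ℕ))) (w := m+1) (h := m+1) (by omega) (by omega) h1, h1,
        hfar (a:ℕ) (by omega) (by omega) (w1 (a:ℕ), w2 (a:ℕ)) h2⟩
    · intro a i j h1 h2 h3 h4
      obtain ⟨-, -, -, h⟩ := hw (a:ℕ) (by omega) (by push_cast; omega)
      have := h (by push_cast; omega) i j h1 h2 h3 (by push_cast; omega)
      simpa using this
  · intro a i j h1 h2 h3 h4
    obtain ⟨-, -, h, -⟩ := hw (a:ℕ) (by omega) (by push_cast; omega)
    exact h i j (by omega) (by push_cast; omega) h3 (by push_cast; omega) (by omega)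

lemma Str_det {n m : ℕ} {p p' : Pic} {c r δ : ℤ} {S : Finset (ℤ × ℤ)} {f : Fin (m+1) → ℤ × ℤ}
    (hδ : 0 ≤ δ ∧ δ ≤ 1) (hf : f ∈ Wk n m S p) (h : Str m δ c r p f) (h' : Str m δ c r p' f)
    (hoff : ∀ x : ℤ × ℤ, x ∉ S → p x.1 x.2 = p' x.1 x.2) :
    ∀ x ∈ bx m (2*m+1) (c + δ, r), p x.1 x.2 = p' x.1 x.2 := by
  intro x hx
  rw [mem_bx] at hx
  push_cast at hx
  obtain ⟨a, ha, j, hj1, hj2, hj⟩ : ∃ a : ℕ, ∃ _ : a < m + 1, ∃ j : ℤ, 0 ≤ j ∧ j < m+1 ∧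
      x.2 = r + a + j := by
    by_cases hle : x.2 - r ≤ m
    · exact ⟨(x.2 - r).toNat, by omega, 0, le_rfl, by omega, by omega⟩
    · exact ⟨m, by omega, x.2 - r - m, by omega, by omega, by omega⟩
  have e1 := h ⟨a, ha⟩ (x.1 - c) j (by omega) (by omega) hj1 hj2
  have e2 := h' ⟨a, ha⟩ (x.1 - c) j (by omega) (by omega) hj1 hj2
  rw [add_sub_cancel] at e1 e2
  simp only at e1 e2
  rw [hj, e1, e2]
  exact Wk_off hf hoff _ _ _ (by omega) (by omega) hj1 hj2

/-- one strip -/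
lemma strip_one {n m M : ℕ} {D : ℤ} {i0 c r δ : ℤ} (hD : 2 * m + 1 ≤ D)
    (hδ : (i0 = 0 ∧ δ = 1) ∨ (i0 = m ∧ δ = 0)) :
    pr n (fun p => Mult n (m+1:ℕ) n M p ∧ E2 n (m+1:ℕ) D p i0 c r) ≤
      (n:ℝ) ^ 2 * M ^ m / 2 ^ (m * (2*m+1)) := by
  refine (pr_mono (F := fun p => (0 ≤ c ∧ c + (m+1) ≤ n ∧ 0 ≤ r ∧ r + 2 * m + 1 ≤ n) ∧
    (Mult n (m+1:ℕ) n M p ∧ E2 n (m+1:ℕ) D p i0 c r)) ?_).trans ?_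
  · rintro p ⟨hp, h⟩
    refine ⟨?_, hp, h⟩
    obtain ⟨h1, h2, h3, h4, -⟩ := h
    push_cast at *
    omega
  refine pr_and _ (by positivity) fun hc => ?_
  have := key n (bx m (2*m+1) (c+δ, r)) ?_ (Wk n m (bx m (2*m+1) (c+δ, r))) (n ^ 2 * M ^ m)
    (fun p => Mult n (m+1:ℕ) n M p ∧ E2 n (m+1:ℕ) D p i0 c r)
    (fun p f => Str m δ c r p f) (fun p hp => Wk_card hp.1) (fun p p' h => Wk_congr h) ?_ ?_
  · rw [card_bx] at this
    exact_mod_cast this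
  · apply bx_sub
    unfold Val
    push_cast
    omega
  · intro p hp
    refine E2_walk hp.2 hδ ?_
    intro a ha1 ha2 v hv
    apply bx_disj
    unfold Far at hv
    push_cast
    omega
  · intro p p' f hf h1 h2 hoff
    exact Str_det (by omega) hf h1 h2 hoff

/-- two disjoint strips -/
lemma strip_two {n m M : ℕ} {D B : ℤ} {c r c' r' : ℤ} (hD : B + 2 * m + 1 ≤ D)
    (h1 : c' + m ≤ c) (h2 : c < c' + B) (h3 : r < r' + B) (h4 : r' < r + B) :
    pr n (fun p => Mult n (m+1:ℕ) n M p ∧ E2 n (m+1:ℕ) D p 0 c r ∧ E2 n (m+1:ℕ) D p m c' r') ≤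
      ((n:ℝ) ^ 2 * M ^ m / 2 ^ (m * (2*m+1))) ^ 2 := by
  classical
  refine (pr_mono (F := fun p => ((0 ≤ c ∧ c + (m+1) ≤ n ∧ 0 ≤ r ∧ r + 2 * m + 1 ≤ n) ∧
    (0 ≤ c' ∧ c' + (m+1) ≤ n ∧ 0 ≤ r' ∧ r' + 2 * m + 1 ≤ n)) ∧
    (Mult n (m+1:ℕ) n M p ∧ E2 n (m+1:ℕ) D p 0 c r ∧ E2 n (m+1:ℕ) D p m c' r')) ?_).trans ?_
  · rintro p ⟨hp, h, h'⟩
    refine ⟨?_, hp, h, h'⟩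
    obtain ⟨h1, h2, h3, h4, -⟩ := h
    obtain ⟨h1', h2', h3', h4', -⟩ := h'
    push_cast at *
    omega
  refine pr_and _ (by positivity) fun hc => ?_
  set S := bx m (2*m+1) (c+1, r) ∪ bx m (2*m+1) (c'+0, r') with hS
  have hdisj : Disjoint (bx m (2*m+1) (c+1, r)) (bx m (2*m+1) (c'+0, r')) := by
    apply bx_disj; simp only; omega
  have := key n S ?_ (fun p => Wk n m S p ×ˢ Wk n m S p) ((n ^ 2 * M ^ m) ^ 2)
    (fun p => Mult n (m+1:ℕ) n M p ∧ E2 n (m+1:ℕ) D p 0 c r ∧ E2 n (m+1:ℕ) D p m c' r')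
    (fun p f => Str m 1 c r p f.1 ∧ Str m 0 c' r' p f.2) ?_
    (fun p p' h => by rw [Wk_congr h]) ?_ ?_
  · refine this.trans (le_of_eq ?_)
    rw [hS, Finset.card_union_of_disjoint hdisj, card_bx, card_bx, div_pow, ← pow_mul]
    push_cast
    congr 2
    ring
  · rw [hS]
    refine Finset.union_subset (bx_sub ?_) (bx_sub ?_) <;>
    · unfold Val
      push_cast
      omega
  · intro p hp
    rw [Finset.card_product, ← pow_two]
    exact Nat.pow_le_pow_left (Wk_card hp.1) 2
  · rintro p ⟨-, hp, hp'⟩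
    obtain ⟨f, hf, hs⟩ := E2_walk (S := S) hp (Or.inl ⟨rfl, rfl⟩) (by
      intro a ha1 ha2 v hv
      rw [hS, Finset.disjoint_union_right]
      unfold Far at hv
      constructor <;>
      · apply bx_disj
        push_cast
        omega)
    obtain ⟨f', hf', hs'⟩ := E2_walk (S := S) hp' (Or.inr ⟨rfl, rfl⟩) (by
      intro a ha1 ha2 v hv
      rw [hS, Finset.disjoint_union_right]
      unfold Far at hv
      constructor <;>
      · apply bx_disj
        push_cast
        omega)
    exact ⟨(f, f'), Finset.mem_product.2 ⟨hf, hf'⟩, hs, hs'⟩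
  · rintro p p' ⟨f, f'⟩ hf ⟨a1, a2⟩ ⟨b1, b2⟩ hoff x hx
    rw [Finset.mem_product] at hf
    rw [hS, Finset.mem_union] at hx
    rcases hx with hx | hx
    · exact Str_det (by omega) hf.1 a1 b1 hoff x hx
    · exact Str_det (by omega) hf.2 a2 b2 hoff x hx

lemma pr_left {n m M B : ℕ} {D : ℤ} (hD : 2 * m + 1 ≤ D) :
    pr n (fun p => Mult n (m+1:ℕ) n M p ∧ ¬ ∀ c r, c < (B:ℤ) → ¬ E2 n (m+1:ℕ) D p 0 c r) ≤
      B * n * ((n:ℝ) ^ 2 * M ^ m / 2 ^ (m * (2*m+1))) := by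
  have := pr_union (n := n) (Finset.Ico (0:ℤ) B ×ˢ Finset.Ico (0:ℤ) n)
    (fun x p => Mult n (m+1:ℕ) n M p ∧ E2 n (m+1:ℕ) D p 0 x.1 x.2)
    ((n:ℝ) ^ 2 * M ^ m / 2 ^ (m * (2*m+1)))
    (G := fun p => Mult n (m+1:ℕ) n M p ∧ ¬ ∀ c r, c < (B:ℤ) → ¬ E2 n (m+1:ℕ) D p 0 c r) ?_ ?_
  · refine this.trans (le_of_eq ?_)
    simp [Finset.card_product]
  · rintro p ⟨hp, h⟩
    push Not at h
    obtain ⟨c, r, hc, h⟩ := h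
    refine ⟨(c, r), ?_, hp, h⟩
    obtain ⟨h1, h2, h3, h4, -⟩ := h
    rw [Finset.mem_product, Finset.mem_Ico, Finset.mem_Ico]
    push_cast at *
    omega
  · intro x _
    exact strip_one hD (Or.inl ⟨rfl, rfl⟩)

lemma pr_right {n m M B : ℕ} {D : ℤ} (hD : 2 * m + 1 ≤ D) :
    pr n (fun p => Mult n (m+1:ℕ) n M p ∧ ¬ ∀ c r, n - (B:ℤ) < c → ¬ E2 n (m+1:ℕ) D p m c r) ≤
      B * n * ((n:ℝ) ^ 2 * M ^ m / 2 ^ (m * (2*m+1))) := by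
  have := pr_union (n := n) (Finset.Ico (n - B:ℤ) n ×ˢ Finset.Ico (0:ℤ) n)
    (fun x p => Mult n (m+1:ℕ) n M p ∧ E2 n (m+1:ℕ) D p m x.1 x.2)
    ((n:ℝ) ^ 2 * M ^ m / 2 ^ (m * (2*m+1)))
    (G := fun p => Mult n (m+1:ℕ) n M p ∧
      ¬ ∀ c r, n - (B:ℤ) < c → ¬ E2 n (m+1:ℕ) D p m c r) ?_ ?_
  · refine this.trans (le_of_eq ?_)
    simp [Finset.card_product]
  · rintro p ⟨hp, h⟩
    push Not at h
    obtain ⟨c, r, hc, h⟩ := h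
    refine ⟨(c, r), ?_, hp, h⟩
    obtain ⟨h1, h2, h3, h4, -⟩ := h
    rw [Finset.mem_product, Finset.mem_Ico, Finset.mem_Ico]
    push_cast at *
    omega
  · intro x _
    exact strip_one hD (Or.inr ⟨rfl, rfl⟩)

lemma pr_pair {n m M B : ℕ} {D : ℤ} (hD : B + 2 * m + 1 ≤ D) :
    pr n (fun p => Mult n (m+1:ℕ) n M p ∧ ¬ ∀ c r c' r' : ℤ, c' + m ≤ c → c < c' + (B:ℤ) →
      r < r' + (B:ℤ) → r' < r + (B:ℤ) →
      ¬ (E2 n (m+1:ℕ) D p 0 c r ∧ E2 n (m+1:ℕ) D p m c' r')) ≤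
      (n:ℝ) ^ 2 * (2 * B) ^ 2 * ((n:ℝ) ^ 2 * M ^ m / 2 ^ (m * (2*m+1))) ^ 2 := by
  have := pr_union (n := n) (sq n ×ˢ (Finset.Ico (-(B:ℤ)) B ×ˢ Finset.Ico (-(B:ℤ)) B))
    (fun x p => (x.2.1 + m ≤ 0 ∧ -x.2.1 < B ∧ -x.2.2 < B ∧ x.2.2 < B) ∧
      (Mult n (m+1:ℕ) n M p ∧ E2 n (m+1:ℕ) D p 0 x.1.1 x.1.2 ∧
      E2 n (m+1:ℕ) D p m (x.1.1 + x.2.1) (x.1.2 + x.2.2)))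
    (((n:ℝ) ^ 2 * M ^ m / 2 ^ (m * (2*m+1))) ^ 2)
    (G := fun p => Mult n (m+1:ℕ) n M p ∧ ¬ ∀ c r c' r' : ℤ, c' + m ≤ c → c < c' + (B:ℤ) →
      r < r' + (B:ℤ) → r' < r + (B:ℤ) →
      ¬ (E2 n (m+1:ℕ) D p 0 c r ∧ E2 n (m+1:ℕ) D p m c' r')) ?_ ?_
  · refine this.trans (le_of_eq ?_)
    rw [Finset.card_product, Finset.card_product, card_sq, Int.card_Ico,
      show ((B:ℤ) - -(B:ℤ)).toNat = 2 * B by omega]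
    push_cast
    ring
  · rintro p ⟨hp, h⟩
    push Not at h
    obtain ⟨c, r, c', r', a1, a2, a3, a4, h, h'⟩ := h
    refine ⟨((c, r), (c' - c, r' - r)), ?_, ?_, hp, h, ?_⟩
    · obtain ⟨h1, h2, h3, h4, -⟩ := h
      rw [Finset.mem_product, Finset.mem_product, Finset.mem_Ico, Finset.mem_Ico, mem_sq]
      push_cast at *
      omega
    · simp only; omega
    · simpa using h'
  · intro x _
    refine pr_and _ (by positivity) fun hc => ?_
    exact strip_two hD (by omega) (by omega) (by omega) (by omega)

end RP

namespace RP

/-- `L = 4 (m+1)^2` -/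
def Lm (m : ℕ) : ℕ := 4 * (m+1) * (m+1)

noncomputable def qq (n m : ℕ) : ℝ := (n:ℝ) ^ 2 / 2 ^ (m * (m+1))

noncomputable def XX (n m : ℕ) : ℝ :=
  (n:ℝ) ^ 2 * ((4 * (m+1) : ℕ) : ℝ) ^ m / 2 ^ (m * (2*m+1))

/-- the union bound -/
noncomputable def TT (n m : ℕ) : ℝ :=
  2 * ((2 * ((8 * Lm m : ℕ) : ℝ) + 1) ^ 2 * qq n m) +
  (n + 1) ^ 2 * ((((4 * Lm m : ℕ) : ℝ) + 3) * qq n m) ^ (4 * (m+1)) +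
  9 * (((2 * (4 * Lm m) + 2 * (m+1) + 10 : ℕ) + 1 : ℝ) ^ 2 * qq n m) +
  (n:ℝ) ^ 2 * qq n m ^ (4 * (m+1)) +
  2 * (((5 * Lm m : ℕ) : ℝ) * n * XX n m) +
  (n:ℝ) ^ 2 * (2 * ((6 * Lm m : ℕ) : ℝ)) ^ 2 * XX n m ^ 2

lemma or_split {a b : Prop} (h : b) : ¬ a ∨ (a ∧ b) := by
  by_cases ha : a
  · exact Or.inr ⟨ha, h⟩
  · exact Or.inl ha

lemma pr_good {n m : ℕ} (hm : 1 ≤ m) :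
    pr n (fun p => ¬ Good n (m+1:ℕ) (4 * Lm m : ℕ) (Lm m) (8 * Lm m : ℕ) p) ≤ TT n m := by
  classical
  have hL : 8 * (m+1) ≤ Lm m := by unfold Lm; nlinarith
  have hL' : Lm m = 4 * (m+1) * (m+1) := rfl
  set D := 8 * Lm m with hD
  set M := 4 * (m+1) with hM
  let U : Finset ℤ := {0, (n:ℤ) / 2 - (4 * Lm m : ℕ) - (m+1:ℕ) - 4, (n:ℤ) - (m+1:ℕ) - (4 * Lm m : ℕ)}
  have hU : U.card ≤ 3 := Finset.card_le_three
  have b1 := pr_near (n := n) (m := m) (D := D) hm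
  have b2 := b1
  rw [← pr_tr] at b2
  have b3 := pr_e1 (n := n) (m := m) (K := 4 * Lm m) (l := 4 * (m+1)) (D := D) hm
    (by rw [← hL']; omega)
  rw [← hL'] at b3
  have b4 := pr_mult (n := n) (m := m) (M := M) (D := D) (by omega)
  have b5 := pr_left (n := n) (m := m) (M := M) (D := D) (B := 5 * Lm m) (by push_cast; omega)
  have b6 := pr_right (n := n) (m := m) (M := M) (D := D) (B := 5 * Lm m) (by push_cast; omega)
  have b7 := pr_pair (n := n) (m := m) (M := M) (D := D) (B := 6 * Lm m) (by push_cast; omega)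
  have b8 := pr_union (n := n) (U ×ˢ U) (fun u p => NoNear n (m+1:ℕ) D p ∧
      ¬ NoRepW n (m+1:ℕ) (2 * (4 * Lm m) + 2 * (m+1) + 10 : ℕ) p u.1 u.2) _
      (G := fun p => NoNear n (m+1:ℕ) D p ∧ ∃ u ∈ U ×ˢ U,
        ¬ NoRepW n (m+1:ℕ) (2 * (4 * Lm m) + 2 * (m+1) + 10 : ℕ) p u.1 u.2)
      (fun p hp => by obtain ⟨h1, u, hu, h2⟩ := hp; exact ⟨u, hu, h1, h2⟩)
      (fun u _ => pr_norep (n := n) (m := m) (D := D) hm (by omega) _ u.1 u.2)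
  have b8' : pr n (fun p => NoNear n (m+1:ℕ) D p ∧ ∃ u ∈ U ×ˢ U,
        ¬ NoRepW n (m+1:ℕ) (2 * (4 * Lm m) + 2 * (m+1) + 10 : ℕ) p u.1 u.2) ≤
        9 * (((2 * (4 * Lm m) + 2 * (m+1) + 10 : ℕ) + 1 : ℝ) ^ 2 * qq n m) := by
    refine b8.trans ?_
    have : (((U ×ˢ U).card : ℕ) : ℝ) ≤ 9 := by
      rw [Finset.card_product]
      have : U.card * U.card ≤ 9 := by nlinarith
      exact_mod_cast this
    unfold qq
    gcongr
  refine le_trans (pr_or (E := fun p => ¬ NoNear n (m+1:ℕ) D p) (F := fun p =>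
    NoNear n (m+1:ℕ) D p ∧ ¬ Good n (m+1:ℕ) (4 * Lm m : ℕ) (Lm m) D p) (fun p hp => or_split hp)) ?_
  have c1 := pr_or (n := n) (G := fun p =>
    NoNear n (m+1:ℕ) D p ∧ ¬ Good n (m+1:ℕ) (4 * Lm m : ℕ) (Lm m) D p)
    (E := fun p => ¬ NoNear n (m+1:ℕ) D (tr p))
    (F := fun p => NoNear n (m+1:ℕ) D p ∧ NoNear n (m+1:ℕ) D (tr p) ∧
      ¬ Good n (m+1:ℕ) (4 * Lm m : ℕ) (Lm m) D p)
    (fun p hp => (or_split (a := NoNear n (m+1:ℕ) D (tr p)) hp.2).imp_right fun h => ⟨hp.1, h⟩)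
  have c2 := pr_or (n := n) (G := fun p => NoNear n (m+1:ℕ) D p ∧ NoNear n (m+1:ℕ) D (tr p) ∧
      ¬ Good n (m+1:ℕ) (4 * Lm m : ℕ) (Lm m) D p)
    (E := fun p => NoNear n (m+1:ℕ) D p ∧ ¬ E1 n (m+1:ℕ) (4 * Lm m : ℕ) (Lm m) p)
    (F := fun p => NoNear n (m+1:ℕ) D p ∧ NoNear n (m+1:ℕ) D (tr p) ∧
      E1 n (m+1:ℕ) (4 * Lm m : ℕ) (Lm m) p ∧
      ¬ Good n (m+1:ℕ) (4 * Lm m : ℕ) (Lm m) D p)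
    (fun p hp => (or_split (a := E1 n (m+1:ℕ) (4 * Lm m : ℕ) (Lm m) p) hp.2.2).imp (fun h => ⟨hp.1, h⟩) fun h => ⟨hp.1, hp.2.1, h⟩)
  have c3 := pr_or (n := n) (G := fun p => NoNear n (m+1:ℕ) D p ∧ NoNear n (m+1:ℕ) D (tr p) ∧
      E1 n (m+1:ℕ) (4 * Lm m : ℕ) (Lm m) p ∧
      ¬ Good n (m+1:ℕ) (4 * Lm m : ℕ) (Lm m) D p)
    (E := fun p => NoNear n (m+1:ℕ) D (tr p) ∧ ¬ Mult n (m+1:ℕ) n M p)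
    (F := fun p => NoNear n (m+1:ℕ) D p ∧ Mult n (m+1:ℕ) n M p ∧
      E1 n (m+1:ℕ) (4 * Lm m : ℕ) (Lm m) p ∧
      ¬ Good n (m+1:ℕ) (4 * Lm m : ℕ) (Lm m) D p)
    (fun p hp => (or_split (a := Mult n (m+1:ℕ) n M p) hp.2.2).imp (fun h => ⟨hp.2.1, h⟩) fun h => ⟨hp.1, h⟩)
  have c4 := pr_or (n := n) (G := fun p => NoNear n (m+1:ℕ) D p ∧ Mult n (m+1:ℕ) n M p ∧
      E1 n (m+1:ℕ) (4 * Lm m : ℕ) (Lm m) p ∧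
      ¬ Good n (m+1:ℕ) (4 * Lm m : ℕ) (Lm m) D p)
    (E := fun p => NoNear n (m+1:ℕ) D p ∧ ∃ u ∈ U ×ˢ U,
        ¬ NoRepW n (m+1:ℕ) (2 * (4 * Lm m) + 2 * (m+1) + 10 : ℕ) p u.1 u.2)
    (F := fun p => (Mult n (m+1:ℕ) n M p ∧
        ¬ ∀ c r, c < ((5 * Lm m : ℕ):ℤ) → ¬ E2 n (m+1:ℕ) D p 0 c r) ∨
      ((Mult n (m+1:ℕ) n M p ∧
        ¬ ∀ c r, n - ((5 * Lm m : ℕ):ℤ) < c → ¬ E2 n (m+1:ℕ) D p m c r) ∨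
      (Mult n (m+1:ℕ) n M p ∧ ¬ ∀ c r c' r' : ℤ, c' + m ≤ c → c < c' + ((6 * Lm m : ℕ):ℤ) →
      r < r' + ((6 * Lm m : ℕ):ℤ) → r' < r + ((6 * Lm m : ℕ):ℤ) →
      ¬ (E2 n (m+1:ℕ) D p 0 c r ∧ E2 n (m+1:ℕ) D p m c' r'))))
    (fun p hp => by
      obtain ⟨g1, g2, g3, g4⟩ := hp
      by_contra hcon
      rw [not_or, not_or, not_or] at hcon
      obtain ⟨k1, k2, k3, k4⟩ := hcon
      apply g4
      refine ⟨g1, g3, ?_, ?_, ?_, ?_⟩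
      · by_contra hc
        refine k2 ⟨g2, ?_⟩
        push_cast
        exact hc
      · by_contra hc
        refine k3 ⟨g2, ?_⟩
        rw [show ((m+1:ℕ):ℤ) - 1 = m by push_cast; ring] at hc
        push_cast at hc ⊢
        exact hc
      · by_contra hc
        refine k4 ⟨g2, ?_⟩
        intro hall
        apply hc
        intro c r c' r' q1 q2 q3 q4
        rw [show ((m+1:ℕ):ℤ) - 1 = m by push_cast; ring]
        refine hall c r c' r' (by push_cast at q1; omega) ?_ ?_ ?_ <;> push_cast <;> omega
      · intro u1 u2 h1 h2
        by_contra hc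
        refine k1 ⟨g1, (u1, u2), ?_, ?_⟩
        · simp only [U, Finset.mem_product, Finset.mem_insert, Finset.mem_singleton]
          exact ⟨h1, h2⟩
        · rw [show ((2 * (4 * Lm m) + 2 * (m+1) + 10 : ℕ) : ℤ) =
            2 * ((4 * Lm m : ℕ) : ℤ) + 2 * ((m+1:ℕ):ℤ) + 10 by push_cast; ring]
          exact hc)
  have c5 := pr_or (n := n) (G := _) (fun p (hp : (Mult n (m+1:ℕ) n M p ∧
        ¬ ∀ c r, c < ((5 * Lm m : ℕ):ℤ) → ¬ E2 n (m+1:ℕ) D p 0 c r) ∨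
      ((Mult n (m+1:ℕ) n M p ∧
        ¬ ∀ c r, n - ((5 * Lm m : ℕ):ℤ) < c → ¬ E2 n (m+1:ℕ) D p m c r) ∨
      (Mult n (m+1:ℕ) n M p ∧ ¬ ∀ c r c' r' : ℤ, c' + m ≤ c → c < c' + ((6 * Lm m : ℕ):ℤ) →
      r < r' + ((6 * Lm m : ℕ):ℤ) → r' < r + ((6 * Lm m : ℕ):ℤ) →
      ¬ (E2 n (m+1:ℕ) D p 0 c r ∧ E2 n (m+1:ℕ) D p m c' r')))) => hp)
  have c6 := pr_or (n := n) (G := _) (fun p (hp : (Mult n (m+1:ℕ) n M p ∧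
        ¬ ∀ c r, n - ((5 * Lm m : ℕ):ℤ) < c → ¬ E2 n (m+1:ℕ) D p m c r) ∨
      (Mult n (m+1:ℕ) n M p ∧ ¬ ∀ c r c' r' : ℤ, c' + m ≤ c → c < c' + ((6 * Lm m : ℕ):ℤ) →
      r < r' + ((6 * Lm m : ℕ):ℤ) → r' < r + ((6 * Lm m : ℕ):ℤ) →
      ¬ (E2 n (m+1:ℕ) D p 0 c r ∧ E2 n (m+1:ℕ) D p m c' r'))) => hp)
  unfold TT
  rw [← hD]
  change _ ≤ _ * qq n m at b1
  change _ ≤ _ * qq n m at b2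
  change _ ≤ _ * (_ * qq n m) ^ _ at b3
  change _ ≤ _ * qq n m ^ _ at b4
  change _ ≤ _ * XX n m at b5
  change _ ≤ _ * XX n m at b6
  change _ ≤ _ * XX n m ^ 2 at b7
  linarith

end RP

namespace RP

set_option maxHeartbeats 2000000 in
lemma TT_bound {β : ℝ} (hβ : 1 < β) (hβ4 : β ^ 4 = 2) {n m k : ℕ} (hk : k = m + 1)
    (hm : 1 ≤ m) (hn : 1 ≤ n)
    (h : (n:ℝ) ^ 2 * β ^ (6 * k) ≤ β ^ (4 * k ^ 2 + 4))
    (hu : 200 * (k:ℝ) ^ 2 * β⁻¹ ^ k ≤ 1)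
    (hv : 3200 * (k:ℝ) ^ 3 * (β⁻¹ ^ 2) ^ k ≤ 1) :
    TT n m ≤ 11 * (20000 * (k:ℝ) ^ 4 * (β⁻¹ ^ 2) ^ k) +
      5 * (200 * (k:ℝ) ^ 2 * β⁻¹ ^ k) +
      2 * (3200 * (k:ℝ) ^ 3 * (β⁻¹ ^ 2) ^ k) := by
  have hβ0 : 0 < β := by linarith
  set g := β⁻¹ with hg
  have hg0 : 0 < g := by positivity
  have hgb : g * β = 1 := by rw [hg]; field_simp
  have hk2 : (2:ℝ) ≤ k := by exact_mod_cast (show 2 ≤ k by omega)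
  have hn1 : (1:ℝ) ≤ n := by exact_mod_cast hn
  have hpow2 : ∀ e : ℕ, (2:ℝ) ^ e = β ^ (4 * e) := fun e => by rw [pow_mul, hβ4]
  have hgk : ∀ e : ℕ, g ^ e * β ^ e = 1 := fun e => by rw [← mul_pow, hgb, one_pow]
  -- bound on q
  have hq0 : 0 ≤ qq n m := by unfold qq; positivity
  have hqb : qq n m ≤ 2 * (g ^ 2) ^ k := by
    have h1 : qq n m * β ^ (2 * k) ≤ 2 := by
      unfold qq
      rw [div_mul_eq_mul_div, div_le_iff₀ (by positivity), hpow2]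
      have : β ^ (4 * k ^ 2 + 4) = 2 * β ^ (4 * (m * (m+1))) * β ^ (4 * k) := by
        rw [← hβ4, ← pow_add, ← pow_add]; congr 1; rw [hk]; ring
      rw [this, show 6 * k = 2 * k + 4 * k by ring, pow_add, ← mul_assoc] at h
      exact le_of_mul_le_mul_right h (by positivity)
    have h2 := hgk (2 * k)
    have : qq n m = (qq n m * β ^ (2*k)) * g ^ (2 * k) := by
      rw [mul_assoc, mul_comm (β ^ (2*k)), h2, mul_one]
    rw [this, ← pow_mul]
    gcongr
  have hn2 : (n:ℝ) ^ 2 ≤ β ^ (4 * k ^ 2) := by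
    have h1 : β ^ 4 ≤ β ^ (6 * k) := pow_le_pow_right₀ hβ.le (by omega)
    have h2 : (n:ℝ) ^ 2 * β ^ (6 * k) ≤ β ^ (4 * k ^ 2) * β ^ (6 * k) := by
      refine h.trans ?_
      rw [pow_add]; gcongr
    exact le_of_mul_le_mul_right h2 (by positivity)
  have hn3 : (n:ℝ) ≤ β ^ (2 * k ^ 2) := by
    have : (n:ℝ) ^ 2 ≤ (β ^ (2 * k ^ 2)) ^ 2 := by
      refine hn2.trans (le_of_eq ?_); rw [← pow_mul]; congr 1; ring
    exact le_of_sq_le_sq this (by positivity)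
  set a : ℝ := 100 * (k:ℝ) ^ 2 with ha
  have ha0 : 0 < a := by positivity
  have ha1 : 1 ≤ a := by nlinarith
  set u := 200 * (k:ℝ) ^ 2 * g ^ k with hudef
  set v := 3200 * (k:ℝ) ^ 3 * (g ^ 2) ^ k with hvdef
  have hu0 : 0 ≤ u := by positivity
  have hv0 : 0 ≤ v := by positivity
  have w1 : a ^ 2 * qq n m ≤ 20000 * (k:ℝ) ^ 4 * (g ^ 2) ^ k := by
    calc a ^ 2 * qq n m ≤ a ^ 2 * (2 * (g ^ 2) ^ k) := by gcongr
      _ = _ := by rw [ha]; ring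
  have w2 : (n:ℝ) ^ 2 * (a * qq n m) ^ (4 * k) ≤ u := by
    have h1 : β ^ k * (a * qq n m) ≤ u := by
      calc β ^ k * (a * qq n m) ≤ β ^ k * (a * (2 * (g ^ 2) ^ k)) := by gcongr
        _ = 200 * (k:ℝ) ^ 2 * g ^ k * (g ^ k * β ^ k) := by rw [ha, pow_right_comm]; ring
        _ = u := by rw [hgk, mul_one]
    calc (n:ℝ) ^ 2 * (a * qq n m) ^ (4 * k) ≤ β ^ (4 * k ^ 2) * (a * qq n m) ^ (4 * k) := by gcongr
      _ = (β ^ k * (a * qq n m)) ^ (4 * k) := by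
        have : β ^ (4 * k ^ 2) = (β ^ k) ^ (4 * k) := by rw [← pow_mul]; congr 1; ring
        rw [this, ← mul_pow]
      _ ≤ u ^ (4 * k) := by gcongr
      _ ≤ u ^ 1 := pow_le_pow_of_le_one hu0 hu (by omega)
      _ = u := pow_one u
  have hX0 : 0 ≤ XX n m := by unfold XX; positivity
  have w3 : a * n * XX n m ≤ v := by
    have e1 : XX n m = qq n m * ((4 * k : ℕ) : ℝ) ^ m * g ^ (4 * (m * m)) := by
      unfold XX qq
      rw [show m * (2 * m + 1) = m * (m+1) + m * m by ring, pow_add, hpow2 (m * m), hg, inv_pow, hk]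
      field_simp
    have e2 : ((4 * k : ℕ) : ℝ) ^ m ≤ (4 * k) ^ k := by
      push_cast
      exact pow_le_pow_right₀ (by linarith) (by omega)
    have e3 : β ^ (2 * k ^ 2) * g ^ (4 * (m * m)) ≤ β ^ (8 * k) * g ^ (2 * k ^ 2) := by
      have i1 := hgk (4 * (m * m))
      have i2 := hgk (2 * k ^ 2)
      have i3 : β ^ (2 * k ^ 2) * β ^ (2 * k ^ 2) ≤ β ^ (8 * k) * β ^ (4 * (m * m)) := by
        rw [← pow_add, ← pow_add]
        exact pow_le_pow_right₀ hβ.le (by rw [hk]; nlinarith)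
      calc β ^ (2 * k ^ 2) * g ^ (4 * (m * m))
          = (β ^ (2 * k ^ 2) * β ^ (2 * k ^ 2)) * (g ^ (4 * (m * m)) * g ^ (2 * k ^ 2)) := by
            linear_combination (-(β ^ (2 * k ^ 2) * g ^ (4 * (m * m)))) * i2
        _ ≤ (β ^ (8 * k) * β ^ (4 * (m * m))) * (g ^ (4 * (m * m)) * g ^ (2 * k ^ 2)) := by
            gcongr
        _ = β ^ (8 * k) * g ^ (2 * k ^ 2) := by
            linear_combination (β ^ (8 * k) * g ^ (2 * k ^ 2)) * i1
    have e4 : β ^ 6 ≤ 4 := by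
      calc β ^ 6 ≤ β ^ 8 := pow_le_pow_right₀ hβ.le (by norm_num)
        _ = (β ^ 4) ^ 2 := by ring
        _ = 4 := by rw [hβ4]; norm_num
    have e5 : (200:ℝ) * (k:ℝ) ^ 2 ≤ (200 * (k:ℝ) ^ 2) ^ k :=
      le_self_pow₀ (by nlinarith) (by omega)
    calc a * n * XX n m
        ≤ a * β ^ (2 * k ^ 2) * ((2 * (g ^ 2) ^ k) * (4 * k) ^ k * g ^ (4 * (m * m))) := by
          rw [e1]; gcongr
      _ = (200 * (k:ℝ) ^ 2) * (4 * k) ^ k * (g ^ 2) ^ k *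
            (β ^ (2 * k ^ 2) * g ^ (4 * (m * m))) := by rw [ha]; ring
      _ ≤ (200 * (k:ℝ) ^ 2) * (4 * k) ^ k * (g ^ 2) ^ k *
            (β ^ (8 * k) * g ^ (2 * k ^ 2)) := by gcongr
      _ = (200 * (k:ℝ) ^ 2) * (4 * k) ^ k * (β ^ 6) ^ k * g ^ (2 * k ^ 2) *
            (g ^ (2 * k) * β ^ (2 * k)) := by
          rw [← pow_mul g 2 k, ← pow_mul β 6 k, show 8 * k = 6 * k + 2 * k by ring, pow_add β]; ring
      _ = (200 * (k:ℝ) ^ 2) * (4 * k) ^ k * (β ^ 6) ^ k * g ^ (2 * k ^ 2) := by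
          rw [hgk, mul_one]
      _ ≤ (200 * (k:ℝ) ^ 2) ^ k * (4 * k) ^ k * 4 ^ k * g ^ (2 * k ^ 2) := by gcongr
      _ = v ^ k := by
          rw [hvdef, ← mul_pow, ← mul_pow, show 2 * k ^ 2 = (2 * k) * k by ring, pow_mul g,
            ← mul_pow, pow_mul g]
          congr 1; ring
      _ ≤ v ^ 1 := pow_le_pow_of_le_one hv0 hv (by omega)
      _ = v := pow_one v
  have hLm : ((Lm m : ℕ) : ℝ) = 4 * (k:ℝ) ^ 2 := by
    unfold Lm; rw [hk]; push_cast; ring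
  have hk4 : 4 ≤ (k:ℝ) ^ 2 := by nlinarith
  have hkk : 2 * (k:ℝ) ≤ (k:ℝ) ^ 2 := by nlinarith
  have hmk : (m:ℝ) + 1 = k := by rw [hk]; push_cast; ring
  have hn4 : ((n:ℝ) + 1) ^ 2 ≤ 4 * (n:ℝ) ^ 2 := by nlinarith
  clear hqb hn2 hn3 h hpow2 hgk
  unfold TT
  generalize qq n m = q at *
  generalize XX n m = X at *
  have t1 : 2 * ((2 * ((8 * Lm m : ℕ) : ℝ) + 1) ^ 2 * q) ≤ 2 * (a ^ 2 * q) := by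
    have i : 2 * ((8 * Lm m : ℕ) : ℝ) + 1 ≤ a := by push_cast; rw [hLm, ha]; linarith
    gcongr
  have t2 : ((n:ℝ) + 1) ^ 2 * ((((4 * Lm m : ℕ) : ℝ) + 3) * q) ^ (4 * (m+1)) ≤
      4 * ((n:ℝ) ^ 2 * (a * q) ^ (4 * k)) := by
    rw [← hk, ← mul_assoc]
    have i2 : ((4 * Lm m : ℕ) : ℝ) + 3 ≤ a := by push_cast; rw [hLm, ha]; linarith
    gcongr
  have t3 : 9 * (((2 * (4 * Lm m) + 2 * (m+1) + 10 : ℕ) + 1 : ℝ) ^ 2 * q) ≤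
      9 * (a ^ 2 * q) := by
    have i : ((2 * (4 * Lm m) + 2 * (m+1) + 10 : ℕ) + 1 : ℝ) ≤ a := by
      push_cast; rw [hLm, hmk, ha]; linarith
    gcongr
  have t4 : (n:ℝ) ^ 2 * q ^ (4 * (m+1)) ≤ (n:ℝ) ^ 2 * (a * q) ^ (4 * k) := by
    have i : q ≤ a * q := le_mul_of_one_le_left hq0 ha1
    rw [← hk]; gcongr
  have t5 : 2 * (((5 * Lm m : ℕ) : ℝ) * n * X) ≤ a * n * X := by
    have i : 2 * ((5 * Lm m : ℕ) : ℝ) ≤ a := by push_cast; rw [hLm, ha]; linarith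
    rw [← mul_assoc, ← mul_assoc]; gcongr
  have t6 : (n:ℝ) ^ 2 * (2 * ((6 * Lm m : ℕ) : ℝ)) ^ 2 * X ^ 2 ≤ v := by
    have i : 2 * ((6 * Lm m : ℕ) : ℝ) ≤ a := by push_cast; rw [hLm, ha]; linarith
    calc (n:ℝ) ^ 2 * (2 * ((6 * Lm m : ℕ) : ℝ)) ^ 2 * X ^ 2
        = ((2 * ((6 * Lm m : ℕ) : ℝ)) * n * X) ^ 2 := by ring
      _ ≤ (a * n * X) ^ 2 := by gcongr
      _ ≤ v ^ 2 := by gcongr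
      _ ≤ v ^ 1 := pow_le_pow_of_le_one hv0 hv (by omega)
      _ = v := pow_one v
  have := add_le_add (add_le_add (add_le_add (add_le_add (add_le_add t1 t2) t3) t4) t5) t6
  have hT : 2 * (a ^ 2 * q) + 4 * ((n:ℝ) ^ 2 * (a * q) ^ (4 * k)) + 9 * (a ^ 2 * q) +
      (n:ℝ) ^ 2 * (a * q) ^ (4 * k) + a * n * X + v ≤
      11 * (20000 * (k:ℝ) ^ 4 * (g ^ 2) ^ k) + 5 * u + 2 * v := by
    linarith
  exact le_trans this hT

lemma exists_beta : ∃ β : ℝ, 1 < β ∧ β ^ 4 = 2 ∧ ∀ (n k : ℕ), 2 ≤ n → 2 ≤ k →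
    Real.sqrt (2 * Real.logb 2 n) < (k:ℝ) - 3/4 →
    (n:ℝ) ^ 2 * β ^ (6 * k) ≤ β ^ (4 * k ^ 2 + 4) := by
  refine ⟨2 ^ (1/4 : ℝ), Real.one_lt_rpow (by norm_num) (by norm_num), ?_, ?_⟩
  · rw [← Real.rpow_natCast, ← Real.rpow_mul (by norm_num)]; norm_num
  · intro n k hn hk h
    have hk2 : (2:ℝ) ≤ k := by exact_mod_cast hk
    have hn0 : (0:ℝ) < n := by positivity
    rw [Real.sqrt_lt' (by linarith)] at h
    have h1 : (n:ℝ) ^ 2 = 2 ^ (2 * Real.logb 2 n) := by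
      rw [mul_comm, Real.rpow_mul (by norm_num), Real.rpow_logb (by norm_num) (by norm_num) hn0]
      norm_cast
    rw [h1, ← Real.rpow_natCast, ← Real.rpow_natCast, ← Real.rpow_mul (by norm_num),
      ← Real.rpow_mul (by norm_num), ← Real.rpow_add (by norm_num)]
    apply Real.rpow_le_rpow_of_exponent_le (by norm_num)
    push_cast
    nlinarith

end RP

namespace RP

lemma legal_of_deck {n k : ℕ} (hkn : k ≤ n) {P P' : Fin n × Fin n → Bool}
    (h : deck n k P' = deck n k P) : Legal n k (ext P) (ext P') := by
  intro x1 x2 hx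
  obtain ⟨h1, h2, h3, h4⟩ := hx
  lift x1 to ℕ using h1
  lift x2 to ℕ using h3
  have hmem : subgrid n k P' x1 x2 ∈ deck n k P' := by
    unfold deck
    refine Multiset.mem_map.2 ⟨(⟨x1, by omega⟩, ⟨x2, by omega⟩), ?_, rfl⟩
    exact Finset.mem_univ _
  rw [h] at hmem
  unfold deck at hmem
  obtain ⟨⟨y1, y2⟩, -, hy⟩ := Multiset.mem_map.1 hmem
  have hy1 := y1.2
  have hy2 := y2.2
  refine ⟨(y1:ℕ), (y2:ℕ), ⟨by omega, by omega, by omega, by omega⟩, ?_⟩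
  intro i j hi hi' hj hj'
  lift i to ℕ using hi
  lift j to ℕ using hj
  have e := congrFun hy (⟨i, by omega⟩, ⟨j, by omega⟩)
  simp only [subgrid] at e
  rw [dif_pos (by constructor <;> omega), dif_pos (by constructor <;> omega)] at e
  have a1 := ext_nat P' (x1 + i) (x2 + j) (by omega) (by omega)
  have a2 := ext_nat P (y1 + i) (y2 + j) (by omega) (by omega)
  push_cast at a1 a2
  rw [a1, a2, e]

lemma legal_mono {n k k0 : ℤ} (hkn : k ≤ n) (hk : k0 ≤ k) {p p' : Pic} (h : Legal n k p p') :
    Legal n k0 p p' := by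
  intro x1 x2 hx
  obtain ⟨h1, h2, h3, h4⟩ := hx
  obtain ⟨y1, y2, ⟨g1, g2, g3, g4⟩, hb⟩ :=
    h (min x1 (n - k)) (min x2 (n - k)) ⟨by omega, by omega, by omega, by omega⟩
  refine ⟨y1 + (x1 - min x1 (n-k)), y2 + (x2 - min x2 (n-k)),
    ⟨by omega, by omega, by omega, by omega⟩, ?_⟩
  intro i j hi hi' hj hj'
  have := hb (x1 - min x1 (n-k) + i) (x2 - min x2 (n-k) + j) (by omega) (by omega) (by omega)
    (by omega)
  convert this using 1
  · congr 1 <;> omega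
  · congr 1 <;> omega

lemma recon_of_good {n k m : ℕ} (hm : 1 ≤ m) (hmk : m + 1 ≤ k) (hkn : k ≤ n)
    (hn : 30 * Lm m + 30 ≤ n) {P : Fin n × Fin n → Bool}
    (h1 : Good n (m+1:ℕ) (4 * Lm m : ℕ) (Lm m) (8 * Lm m : ℕ) (ext P))
    (h2 : Good n (m+1:ℕ) (4 * Lm m : ℕ) (Lm m) (8 * Lm m : ℕ) (tr (ext P))) :
    Reconstructible n k P := by
  intro P' hd
  have l1 := legal_of_deck hkn hd
  have l2 := legal_of_deck hkn hd.symm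
  have l3 := legal_mono (k0 := (m+1:ℕ)) (by omega) (by omega) l1
  have hL : m + 1 ≤ Lm m := by unfold Lm; nlinarith
  obtain ⟨y1, y2, ⟨g1, g2, g3, g4⟩, hb⟩ := l2 (((n:ℤ) - k)/2) (((n:ℤ) - k)/2)
    ⟨by omega, by omega, by omega, by omega⟩
  have hA : Ag n (m+1:ℕ) (ext P) (ext P') (((n:ℤ) - k)/2 - y1) (((n:ℤ) - k)/2 - y2)
      (((n:ℤ) - k)/2 + ((k:ℤ) - (m+1:ℕ))/2) (((n:ℤ) - k)/2 + ((k:ℤ) - (m+1:ℕ))/2) := by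
    refine ⟨⟨by omega, by omega, by omega, by omega⟩, ⟨by omega, by omega, by omega, by omega⟩, ?_⟩
    intro i j hi hi' hj hj'
    have := hb (((k:ℤ) - (m+1:ℕ))/2 + i) (((k:ℤ) - (m+1:ℕ))/2 + j) (by omega) (by omega)
      (by omega) (by omega)
    rw [eq_comm]
    convert this using 1
    · congr 1 <;> omega
    · congr 1 <;> omega
  refine ext_inj ?_
  exact determ (by omega) (by omega) (by omega) (by omega) l3 h1 h2 (by omega) (by omega) hA

lemma reconProb_le (n k : ℕ) : reconProb n k ≤ 1 := by
  classical
  unfold reconProb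
  rw [div_le_one (by positivity)]
  have := Finset.card_filter_le (Finset.univ : Finset (Fin n × Fin n → Bool))
    (fun P => Reconstructible n k P)
  have hc : (Finset.univ : Finset (Fin n × Fin n → Bool)).card = 2 ^ (n^2) := by
    simp
    ring
  rw [hc] at this
  exact_mod_cast this

lemma one_sub_le {n k : ℕ} {E : Pic → Prop}
    (h : ∀ P : Fin n × Fin n → Bool, ¬ Reconstructible n k P → E (ext P)) :
    1 - reconProb n k ≤ pr n E := by
  classical
  have hc : (Finset.univ : Finset (Fin n × Fin n → Bool)).card = 2 ^ (n^2) := by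
    simp
    ring
  have hs := Finset.card_filter_add_card_filter_not (s := (Finset.univ : Finset (Fin n × Fin n → Bool)))
    (fun P => Reconstructible n k P)
  rw [hc] at hs
  have hs' : (((Finset.univ : Finset (Fin n × Fin n → Bool)).filter
    (fun P => Reconstructible n k P)).card : ℝ) + ((Finset.univ.filter
    (fun P : Fin n × Fin n → Bool => ¬ Reconstructible n k P)).card : ℝ) = 2 ^ (n^2) := by
    exact_mod_cast hs
  unfold reconProb pr
  rw [sub_le_iff_le_add, ← add_div, le_div_iff₀ (by positivity), one_mul, ← hs', add_comm]
  refine add_le_add ?_ le_rfl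
  norm_cast
  refine Finset.card_le_card ?_
  intro P hP
  have hP' := (Finset.mem_filter.1 hP).2
  exact Finset.mem_filter.2 ⟨Finset.mem_univ _, h P hP'⟩

lemma reconProb_ge {n k m : ℕ} (hm : 1 ≤ m) (hmk : m + 1 ≤ k) (hkn : k ≤ n)
    (hn : 30 * Lm m + 30 ≤ n) : 1 - 2 * TT n m ≤ reconProb n k := by
  classical
  have a1 := pr_good (n := n) hm
  have a2 := a1
  rw [← pr_tr] at a2
  have a3 := pr_or (n := n) (G := fun p =>
    ¬ (Good n (m+1:ℕ) (4 * Lm m : ℕ) (Lm m) (8 * Lm m : ℕ) p ∧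
       Good n (m+1:ℕ) (4 * Lm m : ℕ) (Lm m) (8 * Lm m : ℕ) (tr p)))
    (E := fun p => ¬ Good n (m+1:ℕ) (4 * Lm m : ℕ) (Lm m) (8 * Lm m : ℕ) p)
    (F := fun p => ¬ Good n (m+1:ℕ) (4 * Lm m : ℕ) (Lm m) (8 * Lm m : ℕ) (tr p))
    (fun p hp => by by_contra hh; push Not at hh; exact hp hh)
  have a4 : 1 - reconProb n k ≤ pr n (fun p =>
    ¬ (Good n (m+1:ℕ) (4 * Lm m : ℕ) (Lm m) (8 * Lm m : ℕ) p ∧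
       Good n (m+1:ℕ) (4 * Lm m : ℕ) (Lm m) (8 * Lm m : ℕ) (tr p))) := by
    refine one_sub_le ?_
    intro P hP hg
    exact hP (recon_of_good hm hmk hkn hn hg.1 hg.2)
  linarith

end RP

namespace RP

lemma tendsto_aux {r : ℝ} (h0 : 0 < r) (h1 : r < 1) (c : ℝ) (j : ℕ) :
    Tendsto (fun k : ℕ => c * (k:ℝ) ^ j * r ^ k) atTop (nhds 0) := by
  have := (tendsto_pow_const_mul_const_pow_of_abs_lt_one j
    (by rw [abs_of_pos h0]; exact h1 : |r| < 1)).const_mul c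
  simpa [mul_assoc] using this

lemma tendsto_s : Tendsto (fun n : ℕ => Real.sqrt (2 * Real.logb 2 n)) atTop atTop := by
  refine Real.tendsto_sqrt_atTop.comp ?_
  refine Tendsto.const_mul_atTop (by norm_num) ?_
  exact (Real.tendsto_logb_atTop (by norm_num)).comp tendsto_natCast_atTop_atTop

lemma size_ok {n m : ℕ} (hn : 2 ≤ n) (hl : Real.log n ≤ 1 / 2000 * n) (hn' : 4000 ≤ n)
    (h : (m : ℝ) - 3 / 4 ≤ Real.sqrt (2 * Real.logb 2 n)) : 30 * Lm m + 30 ≤ n := by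
  have hn2 : (4000:ℝ) ≤ n := by exact_mod_cast hn'
  have hlog : 0 ≤ Real.log n := Real.log_nonneg (by linarith)
  have hb : Real.logb 2 n ≤ 2 * Real.log n := by
    unfold Real.logb
    have := Real.log_two_gt_d9
    rw [div_le_iff₀ (by linarith)]
    nlinarith
  have hb0 : 0 ≤ Real.logb 2 n := Real.logb_nonneg (by norm_num) (by linarith)
  have hs := Real.sq_sqrt (show 0 ≤ 2 * Real.logb 2 n by linarith)
  have hs0 := Real.sqrt_nonneg (2 * Real.logb 2 n)
  set s := Real.sqrt (2 * Real.logb 2 n)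
  have hk : ((m:ℝ) + 1) ^ 2 ≤ 2 * s ^ 2 + 8 := by
    have : ((m:ℝ) + 1) ^ 2 ≤ (s + 2) ^ 2 :=
      pow_le_pow_left₀ (by positivity) (by linarith) 2
    nlinarith [sq_nonneg (s - 2)]
  have : (30 * Lm m + 30 : ℝ) ≤ n := by
    unfold Lm
    push_cast
    nlinarith
  exact_mod_cast this

theorem main_thm (kc k : ℕ → ℕ)
    (hkc : ∀ n : ℕ, 2 ≤ n →
      (kc n : ℝ) - 3 / 4 ≤ Real.sqrt (2 * Real.logb 2 n) ∧
        Real.sqrt (2 * Real.logb 2 n) < (kc n : ℝ) + 1 / 4)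
    (hk : ∀ᶠ n : ℕ in atTop, kc n < k n ∧ k n ≤ n) :
    Tendsto (fun n : ℕ => reconProb n (k n)) atTop (nhds 1) := by
  obtain ⟨β, hβ, hβ4, H⟩ := exists_beta
  have hg0 : 0 < β⁻¹ := by positivity
  have hg1 : β⁻¹ < 1 := inv_lt_one_of_one_lt₀ hβ
  have hg2 : β⁻¹ ^ 2 < 1 := by nlinarith
  have hk0 : Tendsto (fun n => kc n + 1) atTop atTop := by
    rw [← tendsto_natCast_atTop_iff (R := ℝ)]
    refine tendsto_atTop_mono' _ ?_ tendsto_s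
    filter_upwards [eventually_ge_atTop 2] with n hn
    have := (hkc n hn).2
    push_cast
    linarith
  have L1 := tendsto_aux (r := β⁻¹ ^ 2) (by positivity) hg2 20000 4
  have L2 := tendsto_aux hg0 hg1 200 2
  have L3 := tendsto_aux (r := β⁻¹ ^ 2) (by positivity) hg2 3200 3
  have hu := hk0.eventually (L2.eventually (eventually_le_nhds (show (0:ℝ) < 1 by norm_num)))
  have hv := hk0.eventually (L3.eventually (eventually_le_nhds (show (0:ℝ) < 1 by norm_num)))
  have LF := (((L1.const_mul 11).add (L2.const_mul 5)).add (L3.const_mul 2)).comp hk0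
  have LF2 := (LF.const_mul 2).const_sub 1
  simp only [mul_zero, add_zero, sub_zero] at LF2
  have hlog : ∀ᶠ n : ℕ in atTop, Real.log n ≤ 1 / 2000 * n := by
    have := tendsto_natCast_atTop_atTop (R := ℝ) |>.eventually
      (Real.isLittleO_log_id_atTop.bound (show (0:ℝ) < 1 / 2000 by norm_num))
    filter_upwards [this, eventually_ge_atTop 1] with n h hn
    have hn1 : (1:ℝ) ≤ n := by exact_mod_cast hn
    rw [Real.norm_of_nonneg (Real.log_nonneg hn1), id, Real.norm_of_nonneg (by linarith)] at h
    exact h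
  refine tendsto_of_tendsto_of_tendsto_of_le_of_le' LF2 tendsto_const_nhds ?_
    (Eventually.of_forall fun n => reconProb_le n (k n))
  filter_upwards [hk, hu, hv, hlog, eventually_ge_atTop 4000,
    hk0.eventually (eventually_ge_atTop 2)] with n h1 h2 h3 h4 h5 h6
  have h7 := hkc n (by omega)
  have hT := TT_bound (n := n) (m := kc n) hβ hβ4 rfl (by omega) (by omega)
    (H n (kc n + 1) (by omega) (by omega) (by push_cast; linarith [h7.2])) h2 h3
  have hR := reconProb_ge (n := n) (k := k n) (m := kc n) (by omega) (by omega) h1.2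
    (size_ok (by omega) h4 h5 h7.1)
  simp only [Function.comp_apply]
  linarith

end RP

/-- If `kc` is the threshold function (defined for `n ≥ 2` by
`kc n - 3/4 ≤ √(2 log₂ n) < kc n + 1/4`) and `k : ℕ → ℕ` satisfies
`kc n < k n ≤ n` for all sufficiently large `n`, then the probability that a
uniformly random picture of size `n` is reconstructible from its `k n`-deck
tends to `1` as `n → ∞`. -/
theorem reconstruction_above_threshold (kc k : ℕ → ℕ)
    (hkc : ∀ n : ℕ, 2 ≤ n →
      (kc n : ℝ) - 3 / 4 ≤ Real.sqrt (2 * Real.logb 2 n) ∧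
        Real.sqrt (2 * Real.logb 2 n) < (kc n : ℝ) + 1 / 4)
    (hk : ∀ᶠ n : ℕ in atTop, kc n < k n ∧ k n ≤ n) :
    Tendsto (fun n : ℕ => reconProb n (k n)) atTop (nhds 1) := by
  exact RP.main_thm kc k hkc hk
end

section
/- For every function k : ℕ → ℕ satisfying 1 ≤ k(n) < k_c(n) for all sufficiently large n, the probability that a uniformly random picture of size n is reconstructible from its k(n)-deck tends to 0 as n → ∞. -/
open Filter

lemma recon_card_le (n k : ℕ) [DecidablePred fun P : Fin n × Fin n → Bool => Reconstructible n k P] :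
    (Finset.univ.filter fun P : Fin n × Fin n → Bool => Reconstructible n k P).card
      ≤ (2 ^ (k ^ 2) + (n - k + 1) ^ 2).choose ((n - k + 1) ^ 2) := by
  classical
  have hd : ∀ P, Multiset.card (deck n k P) = (n - k + 1) ^ 2 := by
    intro P
    simp [deck, sq]
  let f : (Fin n × Fin n → Bool) → Sym (Fin k × Fin k → Bool) ((n - k + 1) ^ 2) :=
    fun P => ⟨deck n k P, hd P⟩
  have h1 := Finset.card_le_card_of_injOn
    (s := Finset.univ.filter fun P : Fin n × Fin n → Bool => Reconstructible n k P)
    (t := Finset.univ) f (fun _ _ => by simp) (by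
      intro P _ Q hQ h
      have hQ' : Reconstructible n k Q := by simpa using hQ
      exact hQ' P (congrArg Subtype.val h))
  refine h1.trans ?_
  rw [Finset.card_univ, Sym.card_sym_eq_choose]
  have : Fintype.card (Fin k × Fin k → Bool) = 2 ^ (k ^ 2) := by simp [sq]
  rw [this]
  exact Nat.choose_le_choose _ (Nat.sub_le _ _)

lemma choose_bound (M N : ℕ) : ((M + N).choose N : ℝ) ≤ (9 / 8) ^ N * 9 ^ M := by
  have h : (8 : ℝ) ^ N * ((M + N).choose N : ℝ) ≤ 9 ^ (M + N) := by
    have h2 := add_pow (8 : ℝ) 1 (M + N)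
    have h3 : (8 : ℝ) + 1 = 9 := by norm_num
    rw [h3] at h2
    rw [h2]
    have h4 := Finset.single_le_sum
      (f := fun m => (8 : ℝ) ^ m * 1 ^ (M + N - m) * ((M + N).choose m : ℝ))
      (s := Finset.range (M + N + 1)) (fun i _ => by positivity)
      (Finset.mem_range.2 (by omega : N < M + N + 1))
    simpa using h4
  rw [div_pow, div_mul_eq_mul_div, le_div_iff₀ (by positivity)]
  rw [pow_add] at h
  linarith

lemma reconProb_le (n k : ℕ) (hn : 1 ≤ n) (hk : 1 ≤ k) (h : 8 * 2 ^ (k ^ 2) ≤ n ^ 2) :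
    reconProb n k ≤ (3 / 4) ^ n := by
  classical
  unfold reconProb
  rw [div_le_iff₀ (by positivity)]
  have h1 : (((Finset.univ.filter fun P : Fin n × Fin n → Bool =>
      Reconstructible n k P).card : ℕ) : ℝ) ≤
      (((2 ^ (k ^ 2) + (n - k + 1) ^ 2).choose ((n - k + 1) ^ 2) : ℕ) : ℝ) := by
    exact_mod_cast recon_card_le n k
  have hN : (n - k + 1) ^ 2 ≤ n ^ 2 := Nat.pow_le_pow_left (by omega) 2
  have h2 : (9 / 8 : ℝ) ^ ((n - k + 1) ^ 2) ≤ (9 / 8) ^ (n ^ 2) :=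
    pow_le_pow_right₀ (by norm_num) hN
  have h3 : (9 : ℝ) ^ (2 ^ (k ^ 2)) ≤ (4 / 3) ^ (n ^ 2) := by
    calc (9 : ℝ) ^ (2 ^ (k ^ 2)) ≤ ((4 / 3) ^ 8) ^ (2 ^ (k ^ 2)) :=
          pow_le_pow_left₀ (by norm_num) (by norm_num) _
      _ = (4 / 3) ^ (8 * 2 ^ (k ^ 2)) := (pow_mul _ _ _).symm
      _ ≤ _ := pow_le_pow_right₀ (by norm_num) h
  have h4 : (3 / 4 : ℝ) ^ (n ^ 2) ≤ (3 / 4) ^ n :=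
    pow_le_pow_of_le_one (by norm_num) (by norm_num) (by nlinarith)
  calc _ ≤ _ := h1
    _ ≤ _ := choose_bound _ _
    _ ≤ (9 / 8 : ℝ) ^ (n ^ 2) * (4 / 3) ^ (n ^ 2) := by gcongr
    _ = (3 / 4) ^ (n ^ 2) * 2 ^ (n ^ 2) := by
        rw [← mul_pow, ← mul_pow]; norm_num
    _ ≤ _ := by gcongr

lemma size_bound (n k m : ℕ) (hn : 2 ^ 25 ≤ n) (hkm : k < m)
    (h : (m : ℝ) - 3 / 4 ≤ Real.sqrt (2 * Real.logb 2 n)) : 8 * 2 ^ (k ^ 2) ≤ n ^ 2 := by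
  have hn' : (2 : ℝ) ^ 25 ≤ n := by exact_mod_cast hn
  have hpos : (0 : ℝ) < n := lt_of_lt_of_le (by norm_num) hn'
  have hl : (25 : ℝ) ≤ Real.logb 2 n := by
    rw [Real.le_logb_iff_rpow_le (by norm_num) hpos]
    exact_mod_cast hn'
  set s := Real.sqrt (2 * Real.logb 2 n) with hs
  have hss : s ^ 2 = 2 * Real.logb 2 n := Real.sq_sqrt (by linarith)
  have hs7 : 7 ≤ s := Real.le_sqrt_of_sq_le (by linarith)
  have hkm' : (k : ℝ) + 1 ≤ m := by exact_mod_cast hkm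
  have hk : (k : ℝ) ≤ s - 1 / 4 := by linarith
  have hk0 : (0 : ℝ) ≤ k := Nat.cast_nonneg k
  have hkk : (k : ℝ) ^ 2 + 3 ≤ 2 * Real.logb 2 n := by nlinarith
  have h5 : ((k ^ 2 + 3 : ℕ) : ℝ) ≤ Real.logb 2 ((n : ℝ) ^ 2) := by
    rw [Real.logb_pow]; push_cast; exact hkk
  rw [Real.le_logb_iff_rpow_le (by norm_num) (by positivity), Real.rpow_natCast] at h5
  have h6 : 2 ^ (k ^ 2 + 3) ≤ n ^ 2 := by exact_mod_cast h5
  rw [pow_add] at h6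
  linarith

/-- If `kc` is the threshold function (defined for `n ≥ 2` by
`kc n - 3/4 ≤ √(2 log₂ n) < kc n + 1/4`) and `k : ℕ → ℕ` satisfies
`1 ≤ k n < kc n` for all sufficiently large `n`, then the probability that a
uniformly random picture of size `n` is reconstructible from its `k n`-deck
tends to `0` as `n → ∞`. -/
theorem reconstruction_below_threshold (kc k : ℕ → ℕ)
    (hkc : ∀ n : ℕ, 2 ≤ n →
      (kc n : ℝ) - 3 / 4 ≤ Real.sqrt (2 * Real.logb 2 n) ∧
        Real.sqrt (2 * Real.logb 2 n) < (kc n : ℝ) + 1 / 4)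
    (hk : ∀ᶠ n : ℕ in atTop, 1 ≤ k n ∧ k n < kc n) :
    Tendsto (fun n : ℕ => reconProb n (k n)) atTop (nhds 0) := by
  have hlim : Tendsto (fun n : ℕ => (3 / 4 : ℝ) ^ n) atTop (nhds 0) :=
    tendsto_pow_atTop_nhds_zero_of_lt_one (by norm_num) (by norm_num)
  refine tendsto_of_tendsto_of_tendsto_of_le_of_le' tendsto_const_nhds hlim
    (Eventually.of_forall fun n => ?_) ?_
  · unfold reconProb
    positivity
  · filter_upwards [hk, eventually_ge_atTop (2 ^ 25)] with n hkn hn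
    have hn2 : 2 ≤ n := le_trans (by norm_num) hn
    exact reconProb_le n (k n) (by omega) hkn.1
      (size_bound n (k n) (kc n) hn hkn.2 (hkc n hn2).1)
end
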